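/- arXiv:1512.08850 — 9 statements merged into one kernel-verified Lean document; each statement's English description precedes it below -/
import Mathlib

section
/- Let Ω ⊆ ℝⁿ be open and convex, c ≥ 0, and w ∈ W(Ω,c). Then w has a second derivative at Lebesgue-almost every point of Ω: for ℒⁿ-a.e. x ∈ Ω there exist a vector p ∈ ℝⁿ and a symmetric n×n real matrix A such that w(y) = w(x) + ⟨p, y − x⟩ + (1/2)⟨A(y − x), y − x⟩ + o(|y − x|²) as y → x in Ω. -/
open Filter Topology MeasureTheory RealInnerProductSpace Asymptotics

section Alexandrov

variable {E : Type*} [NormedAddCommGroup E] [InnerProductSpace ℝ E]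

/-- A convex function on an open convex set has a subgradient at each point. -/
theorem ConvexOn.exists_inner_subgradient [FiniteDimensional ℝ E] {s : Set E} {f : E → ℝ}
    (hs : IsOpen s) (hf : ConvexOn ℝ s f) {x : E} (hx : x ∈ s) :
    ∃ p : E, ∀ y ∈ s, f x + ⟪p, y - x⟫ ≤ f y := by
  have hcont : ContinuousOn f s := hf.continuousOn hs
  have hopen : IsOpen {z : E × ℝ | z.1 ∈ s ∧ f z.1 < z.2} := by
    rw [isOpen_iff_mem_nhds]
    rintro ⟨a, t⟩ ⟨ha, hat⟩
    have hfa : ContinuousAt (fun z : E × ℝ => f z.1) (a, t) :=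
      ContinuousAt.comp (f := Prod.fst) (x := (a, t)) (hcont.continuousAt (hs.mem_nhds ha))
        continuousAt_fst
    filter_upwards [continuousAt_fst.preimage_mem_nhds (hs.mem_nhds ha),
      hfa.eventually_lt continuousAt_snd hat] with z hz hz'
    exact ⟨hz, hz'⟩
  obtain ⟨φ, hφ⟩ := geometric_hahn_banach_open_point hf.convex_strict_epigraph hopen
    (x := (x, f x)) (fun h => lt_irrefl _ h.2)
  have hsplit : ∀ (y : E) (t : ℝ), φ (y, t) = φ (y, 0) + t * φ (0, 1) := by
    intro y t
    have : ((y, t) : E × ℝ) = (y, 0) + t • (0, 1) := by simp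
    rw [this, map_add, map_smul, smul_eq_mul]
  have hneg : φ (0, 1) < 0 := by
    have h := hφ (x, f x + 1) ⟨hx, by simp⟩
    rw [hsplit, hsplit x (f x)] at h
    linarith
  set b := φ (0, 1)
  let ψ : StrongDual ℝ E := (-b)⁻¹ • φ.comp (ContinuousLinearMap.inl ℝ E ℝ)
  refine ⟨(InnerProductSpace.toDual ℝ E).symm ψ, fun y hy => ?_⟩
  rw [InnerProductSpace.toDual_symm_apply]
  have hle : ∀ t, f y < t → φ (y - x, 0) + b * (t - f x) < 0 := by
    intro t ht
    have h := hφ (y, t) ⟨hy, ht⟩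
    rw [hsplit, hsplit x (f x)] at h
    have : φ (y - x, 0) = φ (y, 0) - φ (x, 0) := by rw [← map_sub]; simp
    rw [this]
    linarith
  refine le_of_forall_gt_imp_ge_of_dense fun t ht => ?_
  have hψ : ψ (y - x) = (-b)⁻¹ * φ (y - x, 0) := rfl
  have h := hle t ht
  have : (-b)⁻¹ * φ (y - x, 0) ≤ t - f x := by
    rw [inv_mul_le_iff₀ (by linarith)]
    linarith
  linarith

/-- A convex function on an open set is differentiable almost everywhere. -/
theorem ConvexOn.ae_differentiableAt [FiniteDimensional ℝ E] [MeasurableSpace E] [BorelSpace E]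
    (μ : Measure E) [μ.IsAddHaarMeasure] {s : Set E} {f : E → ℝ}
    (hs : IsOpen s) (hf : ConvexOn ℝ s f) :
    ∀ᵐ x ∂μ, x ∈ s → DifferentiableAt ℝ f x := by
  rw [ae_iff]
  refine measure_null_of_locally_null _ fun x hx => ?_
  have hxs : x ∈ s := by
    by_contra h
    exact hx fun h' => (h h').elim
  obtain ⟨K, t, ht, hK⟩ := hf.locallyLipschitzOn hs hxs
  rw [hs.nhdsWithin_eq hxs] at ht
  refine ⟨_, inter_mem_nhdsWithin _ (interior_mem_nhds.2 ht), ?_⟩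
  refine measure_mono_null ?_ (ae_iff.1 (hK.ae_differentiableWithinAt_of_mem (μ := μ)))
  rintro z ⟨hz, hzt⟩ h
  exact hz fun _ => (h (interior_subset hzt)).differentiableAt (mem_interior_iff_mem_nhds.1 hzt)

/-- A selection of subgradients is continuous at the points of differentiability. -/
theorem continuousAt_subgradient_of_differentiableAt [CompleteSpace E] {s : Set E} {f : E → ℝ}
    {q : E → E} (hs : IsOpen s) (hq : ∀ x ∈ s, ∀ y ∈ s, f x + ⟪q x, y - x⟫ ≤ f y)
    {x : E} (hx : x ∈ s) (hf : DifferentiableAt ℝ f x) : ContinuousAt q x := by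
  obtain ⟨p, hp⟩ : ∃ p : E, HasGradientAt f p x := ⟨_, hf.hasGradientAt⟩
  have hlim : Tendsto q (𝓝 x) (𝓝 p) := by
    rw [Metric.tendsto_nhds]
    intro ε hε
    have hlo := (hasGradientAt_iff_isLittleO.1 hp).bound (show 0 < ε / 5 by positivity)
    obtain ⟨δ, hδ, hball⟩ := Metric.eventually_nhds_iff.1 (hlo.and (hs.mem_nhds hx))
    refine Metric.eventually_nhds_iff.2 ⟨δ / 2, by positivity, fun z hz => ?_⟩
    rw [dist_eq_norm] at hz ⊢
    by_contra! hcon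
    have hpos : 0 < ‖q z - p‖ := hε.trans_le hcon
    set e : E := (δ / 2 / ‖q z - p‖) • (q z - p) with he
    have hen : ‖e‖ = δ / 2 := by
      rw [he, norm_smul, Real.norm_of_nonneg (by positivity)]
      field_simp
    have hie : ⟪q z - p, e⟫ = δ / 2 * ‖q z - p‖ := by
      rw [he, inner_smul_right, real_inner_self_eq_norm_sq]
      field_simp
    have hze : ‖z + e - x‖ < δ := by
      calc ‖z + e - x‖ = ‖(z - x) + e‖ := by congr 1; abel
        _ ≤ ‖z - x‖ + ‖e‖ := norm_add_le _ _
        _ < δ := by linarith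
    obtain ⟨h1, hzs⟩ := hball (y := z) (by rw [dist_eq_norm]; linarith)
    obtain ⟨h2, hzes⟩ := hball (y := z + e) (by rwa [dist_eq_norm])
    have h3 := hq z hzs (z + e) hzes
    rw [add_sub_cancel_left] at h3
    rw [Real.norm_eq_abs] at h1 h2
    have h4 := (abs_le.1 h1).1
    have h5 := (abs_le.1 h2).2
    have h6 : ⟪p, z + e - x⟫ = ⟪p, z - x⟫ + ⟪p, e⟫ := by
      rw [← inner_add_right]; congr 1; abel
    rw [inner_sub_left] at hie
    have h7 : ε / 5 * ‖z - x‖ ≤ ε / 5 * (δ / 2) := by gcongr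
    have h8 : ε / 5 * ‖z + e - x‖ ≤ ε / 5 * δ := by gcongr
    have h9 : δ / 2 * ε ≤ δ / 2 * ‖q z - p‖ := by gcongr
    nlinarith [mul_pos hε hδ]
  have : q x = p := tendsto_nhds_unique (tendsto_pure_nhds q x)
    (hlim.mono_left (pure_le_nhds x))
  rw [ContinuousAt, this]
  exact hlim

/-- A Lipschitz self-map of a finite-dimensional space sends null sets to null sets. -/
theorem LipschitzWith.addHaar_image_eq_zero [FiniteDimensional ℝ E] [MeasurableSpace E]
    [BorelSpace E] (μ : Measure E) [μ.IsAddHaarMeasure] {K : NNReal} {J : E → E}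
    (hJ : LipschitzWith K J) {t : Set E} (ht : μ t = 0) : μ (J '' t) = 0 := by
  let ν : Measure E := Measure.hausdorffMeasure (Module.finrank ℝ E)
  have hν : ν t = 0 := Measure.absolutelyContinuous_isAddHaarMeasure ν μ ht
  refine Measure.absolutelyContinuous_isAddHaarMeasure μ ν ?_
  have h := hJ.hausdorffMeasure_image_le (Nat.cast_nonneg (Module.finrank ℝ E)) t
  rw [show Measure.hausdorffMeasure (Module.finrank ℝ E : ℝ) t = 0 from hν, mul_zero] at h
  exact nonpos_iff_eq_zero.1 h

/-- A selection of subgradients is differentiable almost everywhere. -/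
theorem ae_exists_hasFDerivAt_subgradient [FiniteDimensional ℝ E] [MeasurableSpace E]
    [BorelSpace E] (μ : Measure E) [μ.IsAddHaarMeasure] {s : Set E} {f : E → ℝ} {q : E → E}
    (hs : IsOpen s) (hf : ConvexOn ℝ s f)
    (hq : ∀ x ∈ s, ∀ y ∈ s, f x + ⟪q x, y - x⟫ ≤ f y) :
    ∀ᵐ x ∂μ, x ∈ s → ∃ A : E →L[ℝ] E, HasFDerivAt q A x := by
  let g : E → E := fun x => x + q x
  have hexp : ∀ x ∈ s, ∀ y ∈ s, ‖x - y‖ ≤ ‖g x - g y‖ := by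
    intro x hx y hy
    have h1 := hq x hx y hy
    have h2 := hq y hy x hx
    have h3 : ⟪q x, y - x⟫ = - ⟪q x, x - y⟫ := by rw [← inner_neg_right, neg_sub]
    have h4 : ⟪g x - g y, x - y⟫ = ‖x - y‖ ^ 2 + (⟪q x, x - y⟫ - ⟪q y, x - y⟫) := by
      rw [← real_inner_self_eq_norm_sq, ← inner_sub_left, ← inner_add_left]
      congr 1
      simp only [g]
      abel
    have h5 := real_inner_le_norm (g x - g y) (x - y)
    by_contra! h
    nlinarith [norm_nonneg (x - y), norm_nonneg (g x - g y)]
  have hinj : Set.InjOn g s := fun x hx y hy h => by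
    have := hexp x hx y hy
    rw [h, sub_self, norm_zero] at this
    exact sub_eq_zero.1 (norm_le_zero_iff.1 this)
  have hinv : ∀ x ∈ s, Function.invFunOn g s (g x) = x := fun x hx =>
    hinj.leftInvOn_invFunOn hx
  have hlip : LipschitzOnWith 1 (Function.invFunOn g s) (g '' s) := by
    refine LipschitzOnWith.of_dist_le_mul ?_
    rintro _ ⟨x, hx, rfl⟩ _ ⟨y, hy, rfl⟩
    rw [hinv x hx, hinv y hy, NNReal.coe_one, one_mul, dist_eq_norm, dist_eq_norm]
    exact hexp x hx y hy
  obtain ⟨J, hJ, hJg⟩ := hlip.extend_finite_dimension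
  have hJinv : ∀ x ∈ s, J (g x) = x := fun x hx => by
    rw [← hJg ⟨x, hx, rfl⟩, hinv x hx]
  have hnull₁ : μ (J '' {y | ¬ DifferentiableAt ℝ J y}) = 0 :=
    hJ.addHaar_image_eq_zero μ (ae_iff.1 hJ.ae_differentiableAt)
  have hnull₂ : μ (J '' {y | DifferentiableAt ℝ J y ∧ (fderiv ℝ J y).det = 0}) = 0 :=
    addHaar_image_eq_zero_of_det_fderivWithin_eq_zero μ
      (fun y hy => hy.1.hasFDerivAt.hasFDerivWithinAt) fun y hy => hy.2
  filter_upwards [measure_eq_zero_iff_ae_notMem.1 hnull₁, measure_eq_zero_iff_ae_notMem.1 hnull₂,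
    hf.ae_differentiableAt μ hs] with x h₁ h₂ h₃ hx
  have hd : DifferentiableAt ℝ J (g x) := by
    by_contra h
    exact h₁ ⟨g x, h, hJinv x hx⟩
  have hdet : (fderiv ℝ J (g x)).det ≠ 0 := fun h => h₂ ⟨g x, ⟨hd, h⟩, hJinv x hx⟩
  have hqc : ContinuousAt q x := continuousAt_subgradient_of_differentiableAt hs hq hx (h₃ hx)
  have hg : HasFDerivAt g _ x := HasFDerivAt.of_local_left_inverse
    (f' := (fderiv ℝ J (g x)).toContinuousLinearEquivOfDetNeZero hdet)
    (continuousAt_id.add hqc) (by simpa using hd.hasFDerivAt)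
    (by filter_upwards [hs.mem_nhds hx] with y hy using hJinv y hy)
  refine ⟨_, (hg.sub (hasFDerivAt_id x)).congr_of_eventuallyEq (.of_forall fun y => ?_)⟩
  simp [g]

/-- A function on `[0, 1]` that is `a`-Lipschitz up to a quadratic error is `a`-Lipschitz. -/
theorem abs_sub_le_of_quadratic_error {ψ : ℝ → ℝ} {a b : ℝ}
    (h : ∀ u ∈ Set.Icc (0 : ℝ) 1, ∀ v ∈ Set.Icc (0 : ℝ) 1,
      ψ v - ψ u ≤ a * |v - u| + b * (v - u) ^ 2) : |ψ 1 - ψ 0| ≤ a := by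
  have hN : ∀ N : ℕ, |ψ 1 - ψ 0| ≤ a + b * (1 / ((N : ℝ) + 1)) := by
    intro N
    have hN0 : (0 : ℝ) < N + 1 := by positivity
    have hmem : ∀ i ≤ N + 1, (i / (N + 1) : ℝ) ∈ Set.Icc (0 : ℝ) 1 := fun i hi =>
      ⟨by positivity, by rw [div_le_one hN0]; exact_mod_cast hi⟩
    have hsum := dist_le_range_sum_of_dist_le (f := fun i : ℕ => ψ (i / (N + 1))) (N + 1)
      (d := fun _ => a * (1 / (N + 1)) + b * (1 / (N + 1)) ^ 2) (fun {i} hi => by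
        have h1 := h _ (hmem i hi.le) _ (hmem (i + 1) hi)
        have h2 := h _ (hmem (i + 1) hi) _ (hmem i hi.le)
        have e : ((i + 1 : ℕ) / (N + 1) : ℝ) - i / (N + 1) = 1 / (N + 1) := by
          push_cast; ring
        have hp : (0 : ℝ) ≤ 1 / (N + 1) := by positivity
        rw [abs_sub_comm, ← neg_sq, neg_sub] at h2
        rw [e, abs_of_nonneg hp] at h1 h2
        rw [Real.dist_eq, abs_le]
        constructor <;> linarith)
    simp only [Finset.sum_const, Finset.card_range, nsmul_eq_mul] at hsum
    rw [Real.dist_eq, abs_sub_comm] at hsum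
    push_cast at hsum
    rw [div_self hN0.ne', zero_div] at hsum
    refine hsum.trans (le_of_eq ?_)
    field_simp
  have hlim : Tendsto (fun N : ℕ => a + b * (1 / ((N : ℝ) + 1))) atTop (𝓝 (a + b * 0)) :=
    (tendsto_one_div_add_atTop_nhds_zero_nat.const_mul b).const_add a
  rw [mul_zero, add_zero] at hlim
  exact ge_of_tendsto' hlim hN

/-- Integrating a first-order expansion of the subgradients along segments. -/
theorem isLittleO_taylor_of_hasFDerivAt_subgradient {s : Set E} {f : E → ℝ} {q : E → E}
    (hs : IsOpen s) (hq : ∀ x ∈ s, ∀ y ∈ s, f x + ⟪q x, y - x⟫ ≤ f y) {x : E} (hx : x ∈ s)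
    {A : E →L[ℝ] E} (hA : HasFDerivAt q A x) :
    (fun y => f y - f x - ⟪q x, y - x⟫ - (1 / 2) * ⟪A (y - x), y - x⟫)
      =o[𝓝 x] fun y => ‖y - x‖ ^ 2 := by
  refine IsLittleO.of_bound fun ε hε => ?_
  obtain ⟨δ, hδ, hball⟩ := Metric.eventually_nhds_iff.1
    ((hA.isLittleO.bound hε).and (hs.mem_nhds hx))
  refine Metric.eventually_nhds_iff.2 ⟨δ, hδ, fun y hy => ?_⟩
  obtain ⟨h, rfl⟩ : ∃ h, y = x + h := ⟨y - x, by abel⟩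
  rw [dist_eq_norm, add_sub_cancel_left] at hy
  have hseg : ∀ t ∈ Set.Icc (0 : ℝ) 1,
      ‖q (x + t • h) - q x - t • A h‖ ≤ ε * ‖h‖ ∧ x + t • h ∈ s := by
    intro t ht
    have hth : ‖t • h‖ ≤ ‖h‖ := by
      rw [norm_smul, Real.norm_of_nonneg ht.1]
      exact mul_le_of_le_one_left (norm_nonneg _) ht.2
    obtain ⟨h1, h2⟩ := hball (y := x + t • h)
      (by rw [dist_eq_norm, add_sub_cancel_left]; exact hth.trans_lt hy)
    rw [add_sub_cancel_left, map_smul] at h1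
    exact ⟨h1.trans (by gcongr), h2⟩
  have key := abs_sub_le_of_quadratic_error
    (ψ := fun t => f (x + t • h) - t * ⟪q x, h⟫ - t ^ 2 / 2 * ⟪A h, h⟫)
    (a := ε * ‖h‖ ^ 2) (b := ⟪A h, h⟫ / 2) (fun u hu v hv => by
      have h1 := hq _ (hseg v hv).2 _ (hseg u hu).2
      have h2 : x + u • h - (x + v • h) = (u - v) • h := by rw [sub_smul]; abel
      rw [h2, inner_smul_right] at h1
      set r := q (x + v • h) - q x - v • A h with hr
      have h3 : q (x + v • h) = r + q x + v • A h := by rw [hr]; abel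
      rw [h3, inner_add_left, inner_add_left, real_inner_smul_left] at h1
      have h4 : (v - u) * ⟪r, h⟫ ≤ ε * ‖h‖ ^ 2 * |v - u| := by
        calc (v - u) * ⟪r, h⟫ ≤ |v - u| * (‖r‖ * ‖h‖) :=
              (le_abs_self _).trans (by
                rw [abs_mul]; gcongr; exact abs_real_inner_le_norm _ _)
          _ ≤ |v - u| * (ε * ‖h‖ * ‖h‖) := by gcongr; exact (hseg v hv).1
          _ = ε * ‖h‖ ^ 2 * |v - u| := by ring
      nlinarith)
  rw [Real.norm_eq_abs, norm_pow, norm_norm, add_sub_cancel_left]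
  refine le_of_eq_of_le ?_ key
  congr 1
  simp only [one_smul, zero_smul, add_zero]
  ring

/-- Alexandrov's theorem for convex functions on a finite-dimensional inner product space. -/
theorem ConvexOn.ae_exists_second_order_expansion [FiniteDimensional ℝ E] [MeasurableSpace E]
    [BorelSpace E] (μ : Measure E) [μ.IsAddHaarMeasure] {s : Set E} {f : E → ℝ}
    (hs : IsOpen s) (hf : ConvexOn ℝ s f) :
    ∀ᵐ x ∂μ, x ∈ s → ∃ (p : E) (A : E →L[ℝ] E),
      (fun y => f y - f x - ⟪p, y - x⟫ - (1 / 2) * ⟪A (y - x), y - x⟫)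
        =o[𝓝 x] fun y => ‖y - x‖ ^ 2 := by
  choose! q hq using fun x hx => hf.exists_inner_subgradient hs (x := x) hx
  filter_upwards [ae_exists_hasFDerivAt_subgradient μ hs hf hq] with x h hx
  obtain ⟨A, hA⟩ := h hx
  exact ⟨q x, A, isLittleO_taylor_of_hasFDerivAt_subgradient hs hq hx hA⟩

end Alexandrov

/-- Every quadratic form on Euclidean space is represented by a symmetric matrix. -/
theorem exists_isSymm_inner_toEuclideanLin_eq {ι : Type*} [Fintype ι] [DecidableEq ι]
    (T : EuclideanSpace ℝ ι →ₗ[ℝ] EuclideanSpace ℝ ι) :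
    ∃ A : Matrix ι ι ℝ, A.IsSymm ∧ ∀ v, ⟪Matrix.toEuclideanLin A v, v⟫ = ⟪T v, v⟫ := by
  set M := Matrix.toEuclideanLin.symm T with hM
  have hT : Matrix.toEuclideanLin M = T := by simp [hM]
  refine ⟨(1 / 2 : ℝ) • (M + M.transpose), ?_, fun v => ?_⟩
  · rw [Matrix.IsSymm, Matrix.transpose_smul, Matrix.transpose_add, Matrix.transpose_transpose,
      add_comm]
  · have h : ⟪Matrix.toEuclideanLin M.transpose v, v⟫ = ⟪T v, v⟫ := by
      rw [← Matrix.conjTranspose_eq_transpose_of_trivial,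
        Matrix.toEuclideanLin_conjTranspose_eq_adjoint, LinearMap.adjoint_inner_left, hT,
        real_inner_comm]
    rw [map_smul, map_add, LinearMap.smul_apply, LinearMap.add_apply, real_inner_smul_left,
      inner_add_left, h, hT]
    ring

/-- a semi-convex function `w ∈ W(Ω, c)` on an open convex set
`Ω ⊆ ℝⁿ` has a second derivative (in the sense of a second-order Taylor
expansion) at Lebesgue-almost every point of `Ω`: for a.e. `x ∈ Ω` there are a
vector `p ∈ ℝⁿ` and a symmetric `n × n` real matrix `A` such that
`w y = w x + ⟪p, y - x⟫ + (1/2)⟪A(y - x), y - x⟫ + o(‖y - x‖²)` as `y → x` in `Ω`. -/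
theorem semiconvex_ae_second_derivative (n : ℕ) (hn : 1 ≤ n)
    (Ω : Set (EuclideanSpace ℝ (Fin n))) (hΩo : IsOpen Ω) (hΩc : Convex ℝ Ω)
    (c : ℝ) (hc : 0 ≤ c) (w : EuclideanSpace ℝ (Fin n) → ℝ)
    (hw : ConvexOn ℝ Ω fun x => w x + c / 2 * ‖x‖ ^ 2) :
    ∀ᵐ x ∂(volume : Measure (EuclideanSpace ℝ (Fin n))), x ∈ Ω →
      ∃ (p : EuclideanSpace ℝ (Fin n)) (A : Matrix (Fin n) (Fin n) ℝ), A.IsSymm ∧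
        (fun y => w y - w x - ⟪p, y - x⟫ -
            (1 / 2) * ⟪Matrix.toEuclideanLin A (y - x), y - x⟫)
          =o[nhdsWithin x Ω] fun y => ‖y - x‖ ^ 2 := by
  filter_upwards [hw.ae_exists_second_order_expansion volume hΩo] with x h hx
  obtain ⟨p, T, hT⟩ := h hx
  obtain ⟨A, hA, hAT⟩ := exists_isSymm_inner_toEuclideanLin_eq
    (T.toLinearMap - c • LinearMap.id)
  refine ⟨p - c • x, A, hA, (hT.mono nhdsWithin_le_nhds).congr_left fun y => ?_⟩
  rw [hAT]
  have hy : ‖y‖ ^ 2 = ‖x‖ ^ 2 + 2 * ⟪x, y - x⟫ + ‖y - x‖ ^ 2 := by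
    rw [← norm_add_sq_real, add_sub_cancel]
  rw [LinearMap.sub_apply, LinearMap.smul_apply, LinearMap.id_apply, inner_sub_left p,
    inner_sub_left (T.toLinearMap (y - x)), real_inner_smul_left, real_inner_smul_left,
    real_inner_self_eq_norm_sq, ContinuousLinearMap.coe_coe, hy]
  ring
end

section
/- Let c ≥ 0, w ∈ W(ℝⁿ,c), and s > c. Then the map sI + ∂w is surjective onto ℝⁿ: for every z ∈ ℝⁿ there exists x ∈ ℝⁿ such that z − sx ∈ ∂w(x). -/
open Filter Topology RealInnerProductSpace

/-- The subgradient of `w` at `x` (here with domain all of `ℝⁿ`):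
`p ∈ ∂w(x)` iff `liminf_{y → x} (w y - w x - ⟪p, y - x⟫)/‖y - x‖ ≥ 0`,
expressed as: for every `ε > 0`, eventually along `y → x`, `y ≠ x`, the
difference quotient is at least `-ε`. -/
def SubGrad {n : ℕ} (Ω : Set (EuclideanSpace ℝ (Fin n)))
    (w : EuclideanSpace ℝ (Fin n) → ℝ) (x : EuclideanSpace ℝ (Fin n)) :
    Set (EuclideanSpace ℝ (Fin n)) :=
  {p | ∀ ε : ℝ, 0 < ε → ∀ᶠ y in nhdsWithin x (Ω \ {x}),
    -ε ≤ (w y - w x - ⟪p, y - x⟫) / ‖y - x‖}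

/-- A convex function on a finite-dimensional space decreases at most linearly. -/
theorem ConvexOn.exists_sub_mul_norm_le {E : Type*} [NormedAddCommGroup E] [NormedSpace ℝ E]
    [FiniteDimensional ℝ E] {g : E → ℝ} (hg : ConvexOn ℝ Set.univ g) :
    ∃ K b : ℝ, ∀ x, b - K * ‖x‖ ≤ g x := by
  obtain ⟨l, b, hle, -⟩ := ConvexOn.exists_affine_le_of_lt (𝕜 := ℝ) (Set.mem_univ (0 : E))
    (sub_one_lt (g 0)) isClosed_univ
    hg.locallyLipschitz.continuous.continuousOn.lowerSemicontinuousOn hg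
  refine ⟨‖l‖, b, fun x => ?_⟩
  have h₁ : l x + b ≤ g x := by simpa using hle ⟨x, Set.mem_univ x⟩
  have h₂ := neg_le_of_abs_le (l.le_opNorm x)
  linarith

/-- A convex function plus a positive multiple of `‖x‖ ^ 2` attains its minimum. -/
theorem ConvexOn.exists_forall_add_sq_norm_le {E : Type*} [NormedAddCommGroup E]
    [NormedSpace ℝ E] [FiniteDimensional ℝ E] {g : E → ℝ} (hg : ConvexOn ℝ Set.univ g)
    {a : ℝ} (ha : 0 < a) : ∃ x, ∀ y, g x + a * ‖x‖ ^ 2 ≤ g y + a * ‖y‖ ^ 2 := by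
  have : ProperSpace E := FiniteDimensional.proper_real E
  have hcont : Continuous fun x => g x + a * ‖x‖ ^ 2 :=
    hg.locallyLipschitz.continuous.add (by fun_prop)
  refine hcont.exists_forall_le ?_
  obtain ⟨K, b, hK⟩ := hg.exists_sub_mul_norm_le
  have hquad : Tendsto (fun t : ℝ => b + t * (a * t - K)) atTop atTop :=
    tendsto_atTop_add_const_left _ _ <| tendsto_id.atTop_mul_atTop₀ <|
      tendsto_atTop_add_const_right _ _ (tendsto_id.const_mul_atTop ha)
  refine tendsto_atTop_mono (fun x => ?_) (hquad.comp (tendsto_norm_cocompact_atTop (E := E)))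
  have := hK x
  simp only [Function.comp_apply]
  linarith

/-- A quadratic lower bound at `x` with linear part `p` makes `p` a subgradient. -/
theorem mem_subGrad_of_forall_le {n : ℕ} {w : EuclideanSpace ℝ (Fin n) → ℝ}
    {x p : EuclideanSpace ℝ (Fin n)} {a : ℝ}
    (h : ∀ y, w x + ⟪p, y - x⟫ - a * ‖y - x‖ ^ 2 ≤ w y) : p ∈ SubGrad Set.univ w x := by
  intro ε hε
  have hlim : Tendsto (fun y => a * ‖y - x‖) (𝓝[Set.univ \ {x}] x) (𝓝 0) := by
    have hc : Continuous fun y => a * ‖y - x‖ := by fun_prop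
    exact (hc.tendsto' x 0 (by simp)).mono_left nhdsWithin_le_nhds
  filter_upwards [hlim.eventually_lt_const hε, self_mem_nhdsWithin] with y hy hyx
  have hpos : 0 < ‖y - x‖ := norm_pos_iff.2 (sub_ne_zero.2 hyx.2)
  rw [le_div_iff₀ hpos]
  nlinarith [h y, mul_lt_mul_of_pos_right hy hpos]

/-- for a semi-convex function `w ∈ W(ℝⁿ, c)` and `s > c`, the map
`sI + ∂w` is surjective onto `ℝⁿ`: for every `z` there is `x` with
`z - s x ∈ ∂w(x)`. -/
theorem sI_add_subgrad_surjective (n : ℕ) (c : ℝ) (hc : 0 ≤ c)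
    (w : EuclideanSpace ℝ (Fin n) → ℝ)
    (hw : ConvexOn ℝ Set.univ fun x => w x + c / 2 * ‖x‖ ^ 2)
    (s : ℝ) (hs : c < s) :
    ∀ z : EuclideanSpace ℝ (Fin n), ∃ x : EuclideanSpace ℝ (Fin n),
      z - s • x ∈ SubGrad Set.univ w x := by
  intro z
  have hconv : ConvexOn ℝ Set.univ fun x => (w x + c / 2 * ‖x‖ ^ 2) - ⟪z, x⟫ :=
    hw.sub ((innerSL ℝ z).toLinearMap.concaveOn convex_univ)
  obtain ⟨x, hx⟩ := hconv.exists_forall_add_sq_norm_le (half_pos (sub_pos.2 hs))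
  refine ⟨x, mem_subGrad_of_forall_le (a := s / 2) fun y => ?_⟩
  have h := hx y
  have hnorm := norm_sub_sq_real y x
  have hinner : ⟪z - s • x, y - x⟫ = ⟪z, y⟫ - ⟪z, x⟫ - s * (⟪y, x⟫ - ‖x‖ ^ 2) := by
    rw [inner_sub_left, inner_sub_right, real_inner_smul_left, inner_sub_right,
      real_inner_self_eq_norm_sq, real_inner_comm x y]
  rw [hinner, hnorm]
  linarith
end

section
/- Let A be a real n×n matrix and c, d > 0. For each subset S ⊆ {1,…,n}, let C_S be the n×n matrix whose i-th row equals the i-th row of A when i ∈ S and equals the i-th row of cI − dA when i ∉ S. Then Σ_{S ⊆ {1,…,n}} (det C_S)² > 0; equivalently, there exists a subset S with det C_S ≠ 0. -/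
open Matrix Finset

/-- Expansion of the determinant of `d • A + B` over the sets of rows taken from `A`. -/
theorem det_smul_add_eq_sum_mixed_rows {ι R : Type*} [Fintype ι] [DecidableEq ι] [CommRing R]
    (A B : Matrix ι ι R) (d : R) :
    (d • A + B).det =
      ∑ S : Finset ι, d ^ S.card *
        (Matrix.of fun i j => if i ∈ S then A i j else B i j).det := by
  have h := (detRowAlternating (n := ι) (R := R)).toMultilinearMap.map_add_univ (d • A) B
  refine h.trans (Finset.sum_congr rfl fun S _ => ?_)
  have hS := (detRowAlternating (n := ι) (R := R)).toMultilinearMap.map_piecewise_smul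
    (fun _ => d) (fun i j => if i ∈ S then A i j else B i j) S
  rw [Finset.prod_const, smul_eq_mul] at hS
  refine Eq.trans (congrArg _ ?_) hS
  ext i j
  by_cases hi : i ∈ S <;> simp [Finset.piecewise, hi]

/-- for a real `n × n` matrix `A` and `c, d > 0`, letting `C_S`
(for `S ⊆ {1, …, n}`) be the matrix whose `i`-th row is the `i`-th row of `A`
for `i ∈ S` and the `i`-th row of `cI - dA` for `i ∉ S`, the sum of the squares
of the determinants `det C_S` over all subsets `S` is strictly positive. -/
theorem sum_sq_det_mixed_rows_pos (n : ℕ)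
    (A : Matrix (Fin n) (Fin n) ℝ) (c d : ℝ) (hc : 0 < c) (hd : 0 < d) :
    0 < ∑ S : Finset (Fin n),
      (Matrix.det (Matrix.of fun i j =>
        if i ∈ S then A i j else (c • (1 : Matrix (Fin n) (Fin n) ℝ) - d • A) i j)) ^ 2 := by
  refine lt_of_le_of_ne (Finset.sum_nonneg fun S _ => sq_nonneg _) fun h_zero => ?_
  have h_det := (Finset.sum_eq_zero_iff_of_nonneg fun S _ => sq_nonneg _).1 h_zero.symm
  have h_exp := det_smul_add_eq_sum_mixed_rows A
    (c • (1 : Matrix (Fin n) (Fin n) ℝ) - d • A) d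
  rw [Finset.sum_eq_zero fun S hS => by
      rw [pow_eq_zero_iff two_ne_zero |>.1 (h_det S hS), mul_zero],
    add_sub_cancel, det_smul, det_one, mul_one] at h_exp
  exact (pow_pos hc _).ne' h_exp
end

section
/- Let Ω ⊆ ℝⁿ, c ≥ 0, and let F : Ω → P₀(ℝⁿ) be a set-valued map whose graph is semi-monotone with constant c, i.e. ⟨y₁ − y₂, x₁ − x₂⟩ ≥ −c|x₁ − x₂|² for all (x₁,y₁), (x₂,y₂) in the graph of F. Let s > c and set cos θ = 2s/√(1+4s²), sin θ = 1/√(1+4s²). Then for all (x₁,y₁), (x₂,y₂) in the graph of F, setting x′ᵢ = cos θ · xᵢ + sin θ · yᵢ and y′ᵢ = −sin θ · xᵢ + cos θ · yᵢ, one has |y′₁ − y′₂| ≤ L |x′₁ − x′₂| with L = max{ 2s, √((4sc+1)/(4s² − 4sc)) }. In particular, the image of the graph of F under the rotation Θ⁻¹ : (x,y) ↦ (cos θ x + sin θ y, −sin θ x + cos θ y) is the graph of an L-Lipschitz function. -/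
open Filter Topology RealInnerProductSpace

/-- A semi-monotone pair of increments satisfies a quadratic cone inequality after an unnormalized
rotation. -/
lemma norm_sq_rotated_le_of_semimonotone {E : Type*} [NormedAddCommGroup E]
    [InnerProductSpace ℝ E] {a b : E} {c s M : ℝ} (hc : 0 ≤ c) (hs : c < s)
    (hab : -c * ‖a‖ ^ 2 ≤ ⟪b, a⟫) (hM : 4 * s ^ 2 ≤ M)
    (hM' : (4 * s * c + 1) / (4 * s ^ 2 - 4 * s * c) ≤ M) :
    ‖(2 * s) • b - a‖ ^ 2 ≤ M * ‖(2 * s) • a + b‖ ^ 2 := by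
  have hs0 : 0 < s := hc.trans_lt hs
  have hden : 0 < 4 * s ^ 2 - 4 * s * c := by nlinarith
  have hM0 : 0 ≤ M := le_trans (by positivity) hM
  rw [div_le_iff₀ hden] at hM'
  rw [norm_sub_sq_real, norm_add_sq_real, real_inner_smul_left, real_inner_smul_left,
    real_inner_comm b a, norm_smul, norm_smul, mul_pow, mul_pow, Real.norm_eq_abs, sq_abs]
  have hinner := mul_le_mul_of_nonneg_left hab (by positivity : 0 ≤ 4 * s * (M + 1))
  have hb := mul_nonneg (sub_nonneg.2 hM) (sq_nonneg ‖b‖)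
  have ha := mul_nonneg (sub_nonneg.2 hM') (sq_nonneg ‖a‖)
  linarith

/-- A semi-monotone pair of increments satisfies the Lipschitz cone condition after rotation. -/
lemma norm_rotated_le_of_semimonotone {E : Type*} [NormedAddCommGroup E]
    [InnerProductSpace ℝ E] {a b : E} {c s : ℝ} (hc : 0 ≤ c) (hs : c < s)
    (hab : -c * ‖a‖ ^ 2 ≤ ⟪b, a⟫) :
    ‖(2 * s) • b - a‖ ≤
      max (2 * s) (√((4 * s * c + 1) / (4 * s ^ 2 - 4 * s * c))) * ‖(2 * s) • a + b‖ := by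
  have hs0 : 0 < s := hc.trans_lt hs
  set L := max (2 * s) (√((4 * s * c + 1) / (4 * s ^ 2 - 4 * s * c)))
  have hsL : 2 * s ≤ L := le_max_left _ _
  have hL0 : 0 ≤ L := by linarith
  refine (sq_le_sq₀ (norm_nonneg _) (by positivity)).1 ?_
  rw [mul_pow]
  refine norm_sq_rotated_le_of_semimonotone hc hs hab (by nlinarith) ?_
  exact (Real.sqrt_le_left hL0).1 (le_max_right _ _)

/-- let `F : Ω → P₀(ℝⁿ)` have a `c`-semi-monotone graph, let
`s > c`, and put `cos θ = 2s/√(1+4s²)`, `sin θ = 1/√(1+4s²)`. Then for graph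
points `(x₁, y₁), (x₂, y₂)`, writing `x′ᵢ = cos θ xᵢ + sin θ yᵢ` and
`y′ᵢ = -sin θ xᵢ + cos θ yᵢ`, one has `‖y′₁ - y′₂‖ ≤ L ‖x′₁ - x′₂‖` with
`L = max {2s, √((4sc+1)/(4s² - 4sc))}`; in particular, the image of the graph
of `F` under the rotation `Θ⁻¹ : (x, y) ↦ (cos θ x + sin θ y, -sin θ x + cos θ y)`
is the graph of a function. -/
theorem rotated_graph_is_lipschitz_graph (n : ℕ)
    (Ω : Set (EuclideanSpace ℝ (Fin n))) (c : ℝ) (hc : 0 ≤ c)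
    (F : EuclideanSpace ℝ (Fin n) → Set (EuclideanSpace ℝ (Fin n)))
    (hFne : ∀ x ∈ Ω, (F x).Nonempty)
    (hmono : ∀ x₁ ∈ Ω, ∀ x₂ ∈ Ω, ∀ y₁ ∈ F x₁, ∀ y₂ ∈ F x₂,
      -c * ‖x₁ - x₂‖ ^ 2 ≤ ⟪y₁ - y₂, x₁ - x₂⟫)
    (s : ℝ) (hs : c < s) (cθ sθ L : ℝ)
    (hcθ : cθ = 2 * s / Real.sqrt (1 + 4 * s ^ 2))
    (hsθ : sθ = 1 / Real.sqrt (1 + 4 * s ^ 2))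
    (hL : L = max (2 * s) (Real.sqrt ((4 * s * c + 1) / (4 * s ^ 2 - 4 * s * c)))) :
    (∀ x₁ ∈ Ω, ∀ x₂ ∈ Ω, ∀ y₁ ∈ F x₁, ∀ y₂ ∈ F x₂,
      ‖(-sθ • x₁ + cθ • y₁) - (-sθ • x₂ + cθ • y₂)‖ ≤
        L * ‖(cθ • x₁ + sθ • y₁) - (cθ • x₂ + sθ • y₂)‖) ∧
    ∃ u : EuclideanSpace ℝ (Fin n) → EuclideanSpace ℝ (Fin n),
      (∀ x ∈ Ω, ∀ y ∈ F x, u (cθ • x + sθ • y) = -sθ • x + cθ • y) ∧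
      ∀ x₁ ∈ Ω, ∀ x₂ ∈ Ω, ∀ y₁ ∈ F x₁, ∀ y₂ ∈ F x₂,
        ‖u (cθ • x₁ + sθ • y₁) - u (cθ • x₂ + sθ • y₂)‖ ≤
          L * ‖(cθ • x₁ + sθ • y₁) - (cθ • x₂ + sθ • y₂)‖ := by
  have hlip : ∀ x₁ ∈ Ω, ∀ x₂ ∈ Ω, ∀ y₁ ∈ F x₁, ∀ y₂ ∈ F x₂,
      ‖(-sθ • x₁ + cθ • y₁) - (-sθ • x₂ + cθ • y₂)‖ ≤
        L * ‖(cθ • x₁ + sθ • y₁) - (cθ • x₂ + sθ • y₂)‖ := by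
    intro x₁ hx₁ x₂ hx₂ y₁ hy₁ y₂ hy₂
    have hcs : cθ = sθ * (2 * s) := by rw [hcθ, hsθ]; ring
    have hy : (-sθ • x₁ + cθ • y₁) - (-sθ • x₂ + cθ • y₂) =
        sθ • ((2 * s) • (y₁ - y₂) - (x₁ - x₂)) := by
      rw [hcs]; module
    have hx : (cθ • x₁ + sθ • y₁) - (cθ • x₂ + sθ • y₂) =
        sθ • ((2 * s) • (x₁ - x₂) + (y₁ - y₂)) := by
      rw [hcs]; module
    rw [hy, hx, norm_smul, norm_smul, mul_left_comm, hL]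
    exact mul_le_mul_of_nonneg_left
      (norm_rotated_le_of_semimonotone hc hs (hmono x₁ hx₁ x₂ hx₂ y₁ hy₁ y₂ hy₂)) (norm_nonneg _)
  refine ⟨hlip, ?_⟩
  let Γ := {p : EuclideanSpace ℝ (Fin n) × EuclideanSpace ℝ (Fin n) // p.1 ∈ Ω ∧ p.2 ∈ F p.1}
  let f : Γ → EuclideanSpace ℝ (Fin n) := fun p => cθ • p.1.1 + sθ • p.1.2
  let g : Γ → EuclideanSpace ℝ (Fin n) := fun p => -sθ • p.1.1 + cθ • p.1.2
  have hfg : g.FactorsThrough f := by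
    intro p q hpq
    have h := hlip _ p.2.1 _ q.2.1 _ p.2.2 _ q.2.2
    rw [show cθ • p.1.1 + sθ • p.1.2 = cθ • q.1.1 + sθ • q.1.2 from hpq, sub_self, norm_zero,
      mul_zero] at h
    exact sub_eq_zero.1 (norm_le_zero_iff.1 h)
  have hu : ∀ x ∈ Ω, ∀ y ∈ F x,
      Function.extend f g 0 (cθ • x + sθ • y) = -sθ • x + cθ • y :=
    fun x hx y hy => hfg.extend_apply 0 ⟨(x, y), hx, hy⟩
  refine ⟨Function.extend f g 0, hu, ?_⟩
  intro x₁ hx₁ x₂ hx₂ y₁ hy₁ y₂ hy₂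
  rw [hu x₁ hx₁ y₁ hy₁, hu x₂ hx₂ y₂ hy₂]
  exact hlip x₁ hx₁ x₂ hx₂ y₁ hy₁ y₂ hy₂
end

section
/- Let Ω ⊆ ℝⁿ, c ≥ 0, and let F : Ω → P₀(ℝⁿ) be a set-valued map with ⟨y₁ − y₂, x₁ − x₂⟩ ≥ −c|x₁ − x₂|² for all (x₁,y₁), (x₂,y₂) in the graph of F. Let s > c and set cos θ = 2s/√(1+4s²), sin θ = 1/√(1+4s²). Then for all (x₁,y₁), (x₂,y₂) in the graph of F, setting x′ᵢ = cos θ · xᵢ + sin θ · yᵢ and y′ᵢ = −sin θ · xᵢ + cos θ · yᵢ, one has ⟨y′₁ − y′₂, x′₁ − x′₂⟩ ≤ 2s |x′₁ − x′₂|². -/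
open Filter Topology RealInnerProductSpace

/-- For a rotation by `θ` with `cos θ = 2 s sin θ`, the defect of the bound
`⟪v, u⟫ ≤ 2 s ‖u‖ ^ 2` in the rotated coordinates `(u, v)` equals `2 s ‖x‖ ^ 2 + ⟪y, x⟫`. -/
lemma two_mul_norm_sq_sub_inner_rotation {E : Type*} [NormedAddCommGroup E]
    [InnerProductSpace ℝ E] {s a b : ℝ} (hab : a = 2 * s * b) (h : a ^ 2 + b ^ 2 = 1)
    (x y : E) :
    2 * s * ‖a • x + b • y‖ ^ 2 - ⟪-b • x + a • y, a • x + b • y⟫ =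
      2 * s * ‖x‖ ^ 2 + ⟪y, x⟫ := by
  rw [← real_inner_self_eq_norm_sq, ← real_inner_self_eq_norm_sq]
  simp only [inner_add_left, inner_add_right, real_inner_smul_left, real_inner_smul_right,
    real_inner_comm y x]
  subst hab
  linear_combination (2 * s * ⟪x, x⟫ + ⟪y, x⟫) * h

/-- let `F : Ω → P₀(ℝⁿ)` have a `c`-semi-monotone graph, let
`s > c`, and put `cos θ = 2s/√(1+4s²)`, `sin θ = 1/√(1+4s²)`. Then for graph
points `(x₁, y₁), (x₂, y₂)`, writing `x′ᵢ = cos θ xᵢ + sin θ yᵢ` and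
`y′ᵢ = -sin θ xᵢ + cos θ yᵢ`, one has `⟪y′₁ - y′₂, x′₁ - x′₂⟫ ≤ 2s ‖x′₁ - x′₂‖²`. -/
theorem rotated_graph_semi_monotone_upper_bound (n : ℕ)
    (Ω : Set (EuclideanSpace ℝ (Fin n))) (c : ℝ) (hc : 0 ≤ c)
    (F : EuclideanSpace ℝ (Fin n) → Set (EuclideanSpace ℝ (Fin n)))
    (hFne : ∀ x ∈ Ω, (F x).Nonempty)
    (hmono : ∀ x₁ ∈ Ω, ∀ x₂ ∈ Ω, ∀ y₁ ∈ F x₁, ∀ y₂ ∈ F x₂,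
      -c * ‖x₁ - x₂‖ ^ 2 ≤ ⟪y₁ - y₂, x₁ - x₂⟫)
    (s : ℝ) (hs : c < s) (cθ sθ : ℝ)
    (hcθ : cθ = 2 * s / Real.sqrt (1 + 4 * s ^ 2))
    (hsθ : sθ = 1 / Real.sqrt (1 + 4 * s ^ 2)) :
    ∀ x₁ ∈ Ω, ∀ x₂ ∈ Ω, ∀ y₁ ∈ F x₁, ∀ y₂ ∈ F x₂,
      ⟪(-sθ • x₁ + cθ • y₁) - (-sθ • x₂ + cθ • y₂),
        (cθ • x₁ + sθ • y₁) - (cθ • x₂ + sθ • y₂)⟫ ≤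
        2 * s * ‖(cθ • x₁ + sθ • y₁) - (cθ • x₂ + sθ • y₂)‖ ^ 2 := by
  intro x₁ hx₁ x₂ hx₂ y₁ hy₁ y₂ hy₂
  have hpos : 0 < 1 + 4 * s ^ 2 := by positivity
  have hab : cθ = 2 * s * sθ := by rw [hcθ, hsθ]; ring
  have hone : cθ ^ 2 + sθ ^ 2 = 1 := by
    rw [hcθ, hsθ, div_pow, div_pow, Real.sq_sqrt hpos.le]
    field_simp
    ring
  have hx : (cθ • x₁ + sθ • y₁) - (cθ • x₂ + sθ • y₂) =
      cθ • (x₁ - x₂) + sθ • (y₁ - y₂) := by module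
  have hy : (-sθ • x₁ + cθ • y₁) - (-sθ • x₂ + cθ • y₂) =
      -sθ • (x₁ - x₂) + cθ • (y₁ - y₂) := by module
  rw [hx, hy, ← sub_nonneg, two_mul_norm_sq_sub_inner_rotation hab hone]
  have hm := hmono x₁ hx₁ x₂ hx₂ y₁ hy₁ y₂ hy₂
  have hnonneg : 0 ≤ (2 * s - c) * ‖x₁ - x₂‖ ^ 2 :=
    mul_nonneg (by linarith) (sq_nonneg _)
  linarith
end

section
/- Let Ω ⊆ ℝⁿ be open, let u, u₁, u₂, … : Ω → ℝⁿ be Lipschitz maps with uniformly bounded Lipschitz constants such that u_k → u uniformly on Ω. Then the minors of the Jacobians converge weakly: for every pair of subsets R, C ⊆ {1,…,n} with |R| = |C|, and every φ ∈ C_c^∞(Ω), one has ∫_Ω φ(x) · det( (Du_k(x))_{R,C} ) dx → ∫_Ω φ(x) · det( (Du(x))_{R,C} ) dx as k → ∞. -/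
open Filter Topology MeasureTheory

/-- The minor of the Jacobian matrix of `u` at `x` with rows indexed by `R`
(components of `u`, in increasing order) and columns indexed by `C`
(coordinate directions, in increasing order). Here `fderiv ℝ u x` is the
(a.e. defined, by Rademacher's theorem) derivative of the Lipschitz map `u`,
with junk value `0` at points of non-differentiability. -/
noncomputable def jacMinor {n : ℕ}
    (u : EuclideanSpace ℝ (Fin n) → EuclideanSpace ℝ (Fin n))
    (R C : Finset (Fin n)) (x : EuclideanSpace ℝ (Fin n)) : ℝ :=
  if h : C.card = R.card then
    Matrix.det (Matrix.of fun a b : Fin R.card =>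
      fderiv ℝ u x (EuclideanSpace.single ((C.orderIsoOfFin h b : Fin n)) 1)
        ((R.orderIsoOfFin rfl a : Fin n)))
  else 0

/-- The determinant of the directional derivatives of the functions `f a` along the vectors
`v b`. -/
noncomputable def jacDet {ι E : Type*} [Fintype ι] [DecidableEq ι] [NormedAddCommGroup E]
    [NormedSpace ℝ E] (v : ι → E) (f : ι → E → ℝ) (x : E) : ℝ :=
  (Matrix.of fun a b => fderiv ℝ (f a) x (v b)).det

section JacDet

variable {ι E : Type*} [Fintype ι] [DecidableEq ι] [NormedAddCommGroup E] [NormedSpace ℝ E]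

lemma jacDet_eq_sum (v : ι → E) (f : ι → E → ℝ) (x : E) :
    jacDet v f x =
      ∑ σ : Equiv.Perm ι, ((Equiv.Perm.sign σ : ℤ) : ℝ) * ∏ a, fderiv ℝ (f a) x (v (σ a)) := by
  rw [jacDet, ← Matrix.det_transpose, Matrix.det_apply']
  rfl

lemma jacDet_update (v : ι → E) (f : ι → E → ℝ) (i : ι) (p : E → ℝ) (x : E) :
    jacDet v (Function.update f i p) x =
      ((Matrix.of fun a b => fderiv ℝ (f a) x (v b)).updateRow i
        (fun b => fderiv ℝ p x (v b))).det := by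
  rw [jacDet]
  congr 1
  ext a b
  by_cases h : a = i
  · subst h; simp
  · simp [h]

lemma jacDet_update_sub (v : ι → E) (f : ι → E → ℝ) (i : ι) {p q : E → ℝ} {x : E}
    (hp : DifferentiableAt ℝ p x) (hq : DifferentiableAt ℝ q x) :
    jacDet v (Function.update f i (fun y => p y - q y)) x =
      jacDet v (Function.update f i p) x - jacDet v (Function.update f i q) x := by
  simp only [jacDet_update, fderiv_fun_sub hp hq]
  rw [eq_sub_iff_add_eq, ← Matrix.det_updateRow_add]
  congr 2
  ext b
  simp

lemma jacDet_update_mul (v : ι → E) (f : ι → E → ℝ) (i : ι) {p q : E → ℝ} {x : E}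
    (hp : DifferentiableAt ℝ p x) (hq : DifferentiableAt ℝ q x) :
    jacDet v (Function.update f i (fun y => p y * q y)) x =
      p x * jacDet v (Function.update f i q) x + q x * jacDet v (Function.update f i p) x := by
  simp only [jacDet_update, fderiv_fun_mul hp hq]
  rw [← Matrix.det_updateRow_smul, ← Matrix.det_updateRow_smul, ← Matrix.det_updateRow_add]
  congr 2

lemma jacDet_update_eq_zero_of_notMem_tsupport (v : ι → E) (f : ι → E → ℝ) (i : ι) {p : E → ℝ}
    {x : E} (hx : x ∉ tsupport p) : jacDet v (Function.update f i p) x = 0 := by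
  rw [jacDet_update]
  refine Matrix.det_eq_zero_of_row_eq_zero i fun b => ?_
  have : fderiv ℝ p x = 0 := by
    by_contra h
    exact hx (support_fderiv_subset ℝ h)
  simp [this]

lemma exists_abs_jacDet_le (v : ι → E) (K : ℝ) :
    ∃ B, ∀ (f : ι → E → ℝ) (x : E), (∀ a, ‖fderiv ℝ (f a) x‖ ≤ K) →
      |jacDet v f x| ≤ B := by
  refine ⟨(Fintype.card ι).factorial • (|K| * ∑ b, ‖v b‖) ^ Fintype.card ι, fun f x h => ?_⟩
  refine Matrix.det_le (abv := AbsoluteValue.abs) fun a b => ?_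
  calc |fderiv ℝ (f a) x (v b)| ≤ ‖fderiv ℝ (f a) x‖ * ‖v b‖ :=
        (fderiv ℝ (f a) x).le_opNorm (v b)
    _ ≤ |K| * ∑ b, ‖v b‖ := by
        refine mul_le_mul ((h a).trans (le_abs_self K)) ?_ (norm_nonneg _) (abs_nonneg _)
        exact Finset.single_le_sum (f := fun b => ‖v b‖) (fun _ _ => norm_nonneg _)
          (Finset.mem_univ b)

lemma tendsto_jacDet (v : ι → E) {h : ℕ → ι → E → ℝ} {f : ι → E → ℝ} {x : E}
    (H : ∀ a, Tendsto (fun k => fderiv ℝ (h k a) x) atTop (𝓝 (fderiv ℝ (f a) x))) :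
    Tendsto (fun k => jacDet v (h k) x) atTop (𝓝 (jacDet v f x)) := by
  simp only [jacDet_eq_sum]
  refine tendsto_finsetSum _ fun σ _ => Tendsto.const_mul _ (tendsto_finsetProd _ fun a _ => ?_)
  exact ((ContinuousLinearMap.apply ℝ ℝ (v (σ a))).continuous.tendsto _).comp (H a)

lemma continuous_jacDet (v : ι → E) {f : ι → E → ℝ} (hf : ∀ a, ContDiff ℝ 1 (f a)) :
    Continuous (jacDet v f) := by
  have h : jacDet v f = fun x => ∑ σ : Equiv.Perm ι,
      ((Equiv.Perm.sign σ : ℤ) : ℝ) * ∏ a, fderiv ℝ (f a) x (v (σ a)) :=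
    funext fun x => jacDet_eq_sum v f x
  rw [h]
  have := fun a => (hf a).continuous_fderiv one_ne_zero
  fun_prop

lemma measurable_jacDet [MeasurableSpace E] [OpensMeasurableSpace E] (v : ι → E)
    (f : ι → E → ℝ) : Measurable (jacDet v f) := by
  have h : jacDet v f = fun x => ∑ σ : Equiv.Perm ι,
      ((Equiv.Perm.sign σ : ℤ) : ℝ) * ∏ a, fderiv ℝ (f a) x (v (σ a)) :=
    funext fun x => jacDet_eq_sum v f x
  rw [h]
  have := fun a b => measurable_fderiv_apply_const ℝ (f a) (v b)
  fun_prop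

/-- The cofactors of the Jacobian matrix of a `C²` map along any row are divergence free. -/
lemma sum_sign_mul_fderiv_prod_erase (v : ι → E) {f : ι → E → ℝ}
    (hf : ∀ a, ContDiff ℝ 2 (f a)) (i : ι) (x : E) :
    ∑ σ : Equiv.Perm ι, ((Equiv.Perm.sign σ : ℤ) : ℝ) *
      fderiv ℝ (fun y => ∏ a ∈ Finset.univ.erase i, fderiv ℝ (f a) y (v (σ a))) x (v (σ i)) =
        0 := by
  have hd : ∀ a, HasFDerivAt (fderiv ℝ (f a)) (fderiv ℝ (fderiv ℝ (f a)) x) x := fun a =>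
    (((hf a).fderiv_right (m := 1) (by norm_num)).differentiable one_ne_zero x).hasFDerivAt
  have hsymm : ∀ a (s t : E), fderiv ℝ (fderiv ℝ (f a)) x s t =
      fderiv ℝ (fderiv ℝ (f a)) x t s := fun a =>
    second_derivative_symmetric
      (fun y => ((hf a).differentiable two_ne_zero y).hasFDerivAt) (hd a)
  have hprod : ∀ σ : Equiv.Perm ι,
      fderiv ℝ (fun y => ∏ a ∈ Finset.univ.erase i, fderiv ℝ (f a) y (v (σ a))) x (v (σ i)) =
        ∑ a ∈ Finset.univ.erase i,
          (∏ b ∈ (Finset.univ.erase i).erase a, fderiv ℝ (f b) x (v (σ b))) *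
            fderiv ℝ (fderiv ℝ (f a)) x (v (σ i)) (v (σ a)) := by
    intro σ
    rw [(HasFDerivAt.finsetProd (u := Finset.univ.erase i)
      (g := fun a y => fderiv ℝ (f a) y (v (σ a)))
      (g' := fun a => (ContinuousLinearMap.apply ℝ ℝ (v (σ a))).comp
        (fderiv ℝ (fderiv ℝ (f a)) x))
      (fun a _ => ((ContinuousLinearMap.apply ℝ ℝ (v (σ a))).hasFDerivAt.comp x (hd a)))).fderiv]
    simp
  simp only [hprod, Finset.mul_sum]
  rw [Finset.sum_comm]
  refine Finset.sum_eq_zero fun a ha => ?_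
  have hai : a ≠ i := Finset.ne_of_mem_erase ha
  set F : Equiv.Perm ι → ℝ := fun σ => ((Equiv.Perm.sign σ : ℤ) : ℝ) *
    ((∏ b ∈ (Finset.univ.erase i).erase a, fderiv ℝ (f b) x (v (σ b))) *
      fderiv ℝ (fderiv ℝ (f a)) x (v (σ i)) (v (σ a))) with hF
  have hneg : ∀ σ, F (σ * Equiv.swap i a) = -F σ := by
    intro σ
    have hp : ∏ b ∈ (Finset.univ.erase i).erase a,
        fderiv ℝ (f b) x (v ((σ * Equiv.swap i a) b)) =
        ∏ b ∈ (Finset.univ.erase i).erase a, fderiv ℝ (f b) x (v (σ b)) := by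
      refine Finset.prod_congr rfl fun b hb => ?_
      simp only [Finset.mem_erase] at hb
      rw [Equiv.Perm.mul_apply, Equiv.swap_apply_of_ne_of_ne hb.2.1 hb.1]
    simp only [hF, hp]
    rw [Equiv.Perm.mul_apply, Equiv.Perm.mul_apply, Equiv.swap_apply_left,
      Equiv.swap_apply_right, hsymm, Equiv.Perm.sign_mul, Equiv.Perm.sign_swap hai.symm]
    push_cast
    ring
  have hsum : ∑ σ, F (σ * Equiv.swap i a) = ∑ σ, F σ :=
    Equiv.sum_comp (Equiv.mulRight (Equiv.swap i a)) F
  simp only [hneg, Finset.sum_neg_distrib] at hsum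
  change ∑ σ, F σ = 0
  linarith

variable [MeasurableSpace E] [BorelSpace E] [FiniteDimensional ℝ E] (μ : Measure E)
  [μ.IsAddHaarMeasure]

lemma integral_jacDet_eq_zero (v : ι → E) {f : ι → E → ℝ} (hf : ∀ a, ContDiff ℝ 2 (f a))
    (i : ι) (hi : HasCompactSupport (f i)) : ∫ x, jacDet v f x ∂μ = 0 := by
  have hc := fun a => (hf a).continuous_fderiv two_ne_zero
  set P : Equiv.Perm ι → E → ℝ := fun σ y =>
    ∏ a ∈ Finset.univ.erase i, fderiv ℝ (f a) y (v (σ a)) with hP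
  have hP1 : ∀ σ, ContDiff ℝ 1 (P σ) := fun σ => contDiff_prod fun a _ =>
    ((hf a).fderiv_right (m := 1) (by norm_num)).clm_apply contDiff_const
  have hPc : ∀ σ, Continuous (P σ) := fun σ => (hP1 σ).continuous
  have hP' := fun σ => (hP1 σ).continuous_fderiv one_ne_zero
  have hic := (hf i).continuous
  have hi' : ∀ w, HasCompactSupport fun x => fderiv ℝ (f i) x w := fun w =>
    hi.fderiv_apply (𝕜 := ℝ) w
  have hint1 : ∀ σ w, Integrable (fun x => P σ x * fderiv ℝ (f i) x w) μ := fun σ w =>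
    Continuous.integrable_of_hasCompactSupport (by fun_prop) (hi' w).mul_left
  have hint2 : ∀ σ w, Integrable (fun x => fderiv ℝ (P σ) x w * f i x) μ := fun σ w =>
    Continuous.integrable_of_hasCompactSupport (by fun_prop) hi.mul_left
  have hint3 : ∀ σ, Integrable (fun x => P σ x * f i x) μ := fun σ =>
    Continuous.integrable_of_hasCompactSupport (by fun_prop) hi.mul_left
  have hparts : ∀ σ w, ∫ x, P σ x * fderiv ℝ (f i) x w ∂μ =
      -∫ x, fderiv ℝ (P σ) x w * f i x ∂μ := fun σ w =>
    integral_mul_fderiv_eq_neg_fderiv_mul_of_integrable (hint2 σ w) (hint1 σ w) (hint3 σ)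
      (fun x _ => (hP1 σ).differentiable one_ne_zero x)
      (fun x _ => (hf i).differentiable two_ne_zero x)
  have hprod : ∀ (σ : Equiv.Perm ι) x, ∏ a, fderiv ℝ (f a) x (v (σ a)) =
      P σ x * fderiv ℝ (f i) x (v (σ i)) := fun σ x =>
    (Finset.prod_erase_mul _ _ (Finset.mem_univ i)).symm
  calc ∫ x, jacDet v f x ∂μ
      = ∑ σ : Equiv.Perm ι, ((Equiv.Perm.sign σ : ℤ) : ℝ) *
          ∫ x, P σ x * fderiv ℝ (f i) x (v (σ i)) ∂μ := by
        simp only [jacDet_eq_sum, hprod]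
        rw [integral_finsetSum _ fun σ _ => (hint1 σ _).const_mul _]
        simp only [integral_const_mul]
    _ = -∫ x, (∑ σ : Equiv.Perm ι, ((Equiv.Perm.sign σ : ℤ) : ℝ) *
          fderiv ℝ (P σ) x (v (σ i))) * f i x ∂μ := by
        simp only [hparts, Finset.sum_mul, mul_assoc]
        rw [integral_finsetSum _ fun σ _ => (hint2 σ _).const_mul _]
        simp only [integral_const_mul, mul_neg, Finset.sum_neg_distrib]
    _ = 0 := by
        simp only [hP, sum_sign_mul_fderiv_prod_erase v hf i]
        simp

end JacDet

section Mollification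

variable {E : Type*} [NormedAddCommGroup E] [NormedSpace ℝ E] [FiniteDimensional ℝ E]
  [MeasurableSpace E] [BorelSpace E] (μ : Measure E) [μ.IsAddHaarMeasure]

/-- The derivative of a mollified Lipschitz function is the mollification of its derivative. -/
lemma LipschitzWith.fderiv_normed_convolution {K : NNReal} {g : E → ℝ} (hg : LipschitzWith K g)
    (ρ : ContDiffBump (0 : E)) (x : E) :
    fderiv ℝ (convolution (ρ.normed μ) g (ContinuousLinearMap.lsmul ℝ ℝ) μ) x =
      convolution (ρ.normed μ) (fderiv ℝ g) (ContinuousLinearMap.lsmul ℝ ℝ) μ x := by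
  have hρc : Continuous (ρ.normed μ) := ρ.continuous_normed
  have hρi : Integrable (ρ.normed μ) μ := ρ.integrable_normed
  have hgc := hg.continuous
  have hmp : Measure.QuasiMeasurePreserving (fun t => x - t) μ μ :=
    quasiMeasurePreserving_sub_left μ x
  refine HasFDerivAt.fderiv ?_
  refine (hasFDerivAt_integral_of_dominated_loc_of_lip (μ := μ)
    (F := fun y t => ρ.normed μ t • g (y - t)) (F' := fun t => ρ.normed μ t • fderiv ℝ g (x - t))
    (bound := fun t => ρ.normed μ t * K) (s := Set.univ) (x₀ := x) univ_mem
    (Eventually.of_forall fun y => by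
      have : Continuous fun t => ρ.normed μ t • g (y - t) := by fun_prop
      exact this.aestronglyMeasurable) ?_ ?_ ?_ (hρi.mul_const _) ?_).2
  · exact Continuous.integrable_of_hasCompactSupport (by fun_prop)
      ρ.hasCompactSupport_normed.smul_right
  · refine hρc.aestronglyMeasurable.smul ?_
    exact ((measurable_fderiv ℝ g).comp
      (measurable_const.sub measurable_id)).aestronglyMeasurable
  · refine Eventually.of_forall fun t => LipschitzOnWith.of_dist_le_mul fun y _ z _ => ?_
    have h0 : 0 ≤ ρ.normed μ t := ρ.nonneg_normed t
    have h1 : |ρ.normed μ t * (K : ℝ)| = ρ.normed μ t * K := abs_of_nonneg (mul_nonneg h0 K.2)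
    rw [Real.coe_nnabs, h1, dist_smul₀, Real.norm_of_nonneg h0, mul_assoc]
    gcongr
    simpa using hg.dist_le_mul (y - t) (z - t)
  · filter_upwards [hmp.ae hg.ae_differentiableAt] with t ht
    have h1 : HasFDerivAt (fun y => g (y - t)) (fderiv ℝ g (x - t)) x :=
      ht.hasFDerivAt.comp x ((hasFDerivAt_id x).sub_const t)
    exact h1.const_smul (ρ.normed μ t)

/-- Smooth approximation of Lipschitz functions with uniform derivative bounds and almost everywhere
convergence of the derivatives. -/
lemma LipschitzWith.exists_contDiff_approx {K : NNReal} {g : E → ℝ} (hg : LipschitzWith K g) :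
    ∃ h : ℕ → E → ℝ, (∀ k, ContDiff ℝ 2 (h k)) ∧ (∀ k x, ‖fderiv ℝ (h k) x‖ ≤ K) ∧
      (∀ k x, |h k x - g x| ≤ K) ∧ (∀ x, Tendsto (fun k => h k x) atTop (𝓝 (g x))) ∧
      ∀ᵐ x ∂μ, Tendsto (fun k => fderiv ℝ (h k) x) atTop (𝓝 (fderiv ℝ g x)) := by
  let ρ : ℕ → ContDiffBump (0 : E) := fun k =>
    { rIn := ((k : ℝ) + 2)⁻¹
      rOut := 2 * ((k : ℝ) + 2)⁻¹
      rIn_pos := by positivity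
      rIn_lt_rOut := by
        have : 0 < ((k : ℝ) + 2)⁻¹ := by positivity
        linarith }
  have hr1 : ∀ k, (ρ k).rOut ≤ 1 := fun k => by
    change 2 * ((k : ℝ) + 2)⁻¹ ≤ 1
    rw [← div_eq_mul_inv, div_le_one (by positivity)]
    linarith [(Nat.cast_nonneg k : (0 : ℝ) ≤ k)]
  have hr : Tendsto (fun k => (ρ k).rOut) atTop (𝓝 0) := by
    have : Tendsto (fun k : ℕ => 2 * ((k : ℝ) + 2)⁻¹) atTop (𝓝 (2 * 0)) :=
      (tendsto_inv_atTop_zero.comp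
        (tendsto_atTop_add_const_right _ 2 tendsto_natCast_atTop_atTop)).const_mul 2
    simpa using this
  have hbdd : ∀ x, ‖fderiv ℝ g x‖ ≤ K := fun x => norm_fderiv_le_of_lipschitz ℝ hg
  have hloc : LocallyIntegrable (fderiv ℝ g) μ :=
    (locallyIntegrable_const (K : ℝ)).mono (measurable_fderiv ℝ g).aestronglyMeasurable
      (Eventually.of_forall fun x => by simpa using hbdd x)
  refine ⟨fun k => convolution ((ρ k).normed μ) g (ContinuousLinearMap.lsmul ℝ ℝ) μ,
    fun k => ?_, fun k x => ?_, fun k x => ?_, fun x => ?_, ?_⟩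
  · exact (ρ k).hasCompactSupport_normed.contDiff_convolution_left (n := 2) _
      (ρ k).contDiff_normed hg.continuous.locallyIntegrable
  · rw [hg.fderiv_normed_convolution μ (ρ k) x, convolution_def]
    calc ‖∫ t, ContinuousLinearMap.lsmul ℝ ℝ ((ρ k).normed μ t) (fderiv ℝ g (x - t)) ∂μ‖
        ≤ ∫ t, (ρ k).normed μ t * K ∂μ := by
          refine norm_integral_le_of_norm_le ((ρ k).integrable_normed.mul_const _)
            (Eventually.of_forall fun t => ?_)
          have h0 : 0 ≤ (ρ k).normed μ t := (ρ k).nonneg_normed t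
          rw [ContinuousLinearMap.lsmul_apply, norm_smul, Real.norm_of_nonneg h0]
          exact mul_le_mul_of_nonneg_left (hbdd _) h0
      _ = K := by rw [integral_mul_const, (ρ k).integral_normed, one_mul]
  · rw [← Real.dist_eq]
    refine ContDiffBump.dist_normed_convolution_le hg.continuous.aestronglyMeasurable
      fun y hy => (hg.dist_le_mul y x).trans ?_
    exact mul_le_of_le_one_right K.2 ((Metric.mem_ball.1 hy).le.trans (hr1 k))
  · exact ContDiffBump.convolution_tendsto_right_of_continuous hr hg.continuous x
  · filter_upwards [ContDiffBump.ae_convolution_tendsto_right_of_locallyIntegrable (K := 2) hr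
      (Eventually.of_forall fun k => le_rfl) hloc] with x hx
    simpa only [hg.fderiv_normed_convolution μ] using hx

end Mollification

section WeakContinuity

variable {ι E : Type*} [Fintype ι] [DecidableEq ι] [NormedAddCommGroup E] [NormedSpace ℝ E]
  [MeasurableSpace E] [BorelSpace E] (μ : Measure E) [μ.IsAddHaarMeasure]

lemma HasCompactSupport.integrable_mul_jacDet {K : NNReal} {φ : E → ℝ} (hφ : Continuous φ)
    (hφc : HasCompactSupport φ) (v : ι → E) {f : ι → E → ℝ}
    (hf : ∀ a, LipschitzWith K (f a)) : Integrable (fun x => φ x * jacDet v f x) μ := by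
  obtain ⟨B, hB⟩ := exists_abs_jacDet_le v (K : ℝ)
  exact (hφ.integrable_of_hasCompactSupport hφc).mul_bdd
    (measurable_jacDet v f).aestronglyMeasurable
    (Eventually.of_forall fun x => hB f x fun a => norm_fderiv_le_of_lipschitz ℝ (hf a))

variable [FiniteDimensional ℝ E]

/-- Integration by parts for Jacobian determinants of Lipschitz functions. -/
lemma integral_mul_jacDet_add_eq_zero {K : NNReal} {φ : E → ℝ} (hφ : ContDiff ℝ 2 φ)
    (hφc : HasCompactSupport φ) (hφK : LipschitzWith K φ) (v : ι → E) {f : ι → E → ℝ}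
    (hf : ∀ a, LipschitzWith K (f a)) (i : ι) :
    ∫ x, (φ x * jacDet v f x + f i x * jacDet v (Function.update f i φ) x) ∂μ = 0 := by
  choose h hsm hbd hcl hlim hder using fun a => (hf a).exists_contDiff_approx μ
  obtain ⟨B, hB⟩ := exists_abs_jacDet_le v (K : ℝ)
  obtain ⟨A, hA⟩ := hφ.continuous.bounded_above_of_compact_support hφc
  obtain ⟨M, hM⟩ := hφc.isCompact.exists_bound_of_continuousOn (hf i).continuous.continuousOn
  set F : ℕ → E → ℝ := fun k x => φ x * jacDet v (fun a => h a k) x +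
    h i k x * jacDet v (Function.update (fun a => h a k) i φ) x with hF
  have hupd : ∀ k a, ContDiff ℝ 2 (Function.update (fun a => h a k) i φ a) := by
    intro k a
    by_cases ha : a = i
    · subst ha; simpa using hφ
    · simpa [ha] using hsm a k
  have hupdK : ∀ k a x, ‖fderiv ℝ (Function.update (fun a => h a k) i φ a) x‖ ≤ K := by
    intro k a x
    by_cases ha : a = i
    · subst ha; simpa using norm_fderiv_le_of_lipschitz ℝ hφK
    · simpa [ha] using hbd a k x
  have hzero : ∀ k, ∫ x, F k x ∂μ = 0 := by
    intro k
    have hi : HasCompactSupport (Function.update (fun a => h a k) i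
        (fun y => φ y * h i k y) i) := by
      rw [Function.update_self]
      exact hφc.mul_right
    rw [← integral_jacDet_eq_zero μ v
      (f := Function.update (fun a => h a k) i (fun y => φ y * h i k y)) ?_ i hi]
    · refine integral_congr_ae (Eventually.of_forall fun x => ?_)
      rw [jacDet_update_mul _ _ _ (hφ.differentiable two_ne_zero x)
        ((hsm i k).differentiable two_ne_zero x), Function.update_eq_self i (fun a => h a k)]
    · intro a
      by_cases ha : a = i
      · subst ha; simpa using hφ.mul (hsm a k)
      · simpa [ha] using hsm a k
  have hlim : Tendsto (fun k => ∫ x, F k x ∂μ) atTop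
      (𝓝 (∫ x, (φ x * jacDet v f x + f i x * jacDet v (Function.update f i φ) x) ∂μ)) := by
    refine tendsto_integral_of_dominated_convergence
      ((tsupport φ).indicator fun _ => A * B + (M + K) * B) (fun k => ?_) ?_ (fun k => ?_) ?_
    · have h1 := continuous_jacDet v fun a => (hsm a k).of_le one_le_two
      have h2 := continuous_jacDet v fun a => (hupd k a).of_le one_le_two
      have h3 := (hsm i k).continuous
      have h4 := hφ.continuous
      have : Continuous (F k) := by fun_prop
      exact this.aestronglyMeasurable
    · exact (integrable_indicator_iff (isClosed_tsupport φ).measurableSet).2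
        (integrableOn_const hφc.isCompact.measure_ne_top)
    · refine Eventually.of_forall fun x => ?_
      by_cases hx : x ∈ tsupport φ
      · rw [Set.indicator_of_mem hx]
        have h1 : |h i k x| ≤ M + K := by
          have h2 := hM x hx
          have h3 := hcl i k x
          rw [Real.norm_eq_abs] at h2
          have h4 := abs_add_le (f i x) (h i k x - f i x)
          rw [add_sub_cancel] at h4
          linarith
        refine (norm_add_le _ _).trans (add_le_add ?_ ?_)
        · rw [norm_mul]
          exact mul_le_mul (hA x) (hB _ _ fun a => hbd a k x) (norm_nonneg _)
            ((norm_nonneg _).trans (hA x))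
        · rw [norm_mul]
          exact mul_le_mul h1 (hB _ _ fun a => hupdK k a x) (norm_nonneg _)
            ((abs_nonneg _).trans h1)
      · rw [Set.indicator_of_notMem hx]
        simp [hF, image_eq_zero_of_notMem_tsupport hx,
          jacDet_update_eq_zero_of_notMem_tsupport v _ i hx]
    · filter_upwards [ae_all_iff.2 hder] with x hx
      refine ((tendsto_jacDet v hx).const_mul _).add
        ((hlim i x).mul (tendsto_jacDet v fun a => ?_))
      by_cases ha : a = i
      · subst ha; simp
      · simpa [ha] using hx a
  simp only [hzero] at hlim
  exact tendsto_nhds_unique hlim tendsto_const_nhds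

/-- Replacing one row by a sequence converging uniformly on the support of the test function does
not change the limit of the integral, even when the other rows vary. -/
lemma tendsto_integral_mul_jacDet_update_sub {K : NNReal} {φ : E → ℝ} (hφ : ContDiff ℝ 2 φ)
    (hφc : HasCompactSupport φ) (hφK : LipschitzWith K φ) (v : ι → E) {f : ℕ → ι → E → ℝ}
    (hf : ∀ k a, LipschitzWith K (f k a)) (i : ι) {p : ℕ → E → ℝ} {q : E → ℝ}
    (hp : ∀ k, LipschitzWith K (p k)) (hq : LipschitzWith K q)
    (hpq : TendstoUniformlyOn p q atTop (tsupport φ)) :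
    Tendsto (fun k => (∫ x, φ x * jacDet v (Function.update (f k) i (p k)) x ∂μ) -
      ∫ x, φ x * jacDet v (Function.update (f k) i q) x ∂μ) atTop (𝓝 0) := by
  have hupd : ∀ {r : E → ℝ}, LipschitzWith K r → ∀ k a,
      LipschitzWith K (Function.update (f k) i r a) := by
    intro r hr k a
    by_cases ha : a = i
    · subst ha; simpa using hr
    · simpa [ha] using hf k a
  obtain ⟨B, hB⟩ := exists_abs_jacDet_le v (K : ℝ)
  have key : ∀ k, (∫ x, φ x * jacDet v (Function.update (f k) i (p k)) x ∂μ) -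
      (∫ x, φ x * jacDet v (Function.update (f k) i q) x ∂μ) =
      ∫ x, (q x - p k x) * jacDet v (Function.update (f k) i φ) x ∂μ := by
    intro k
    have hI : ∀ {r : E → ℝ}, LipschitzWith K r →
        Integrable (fun x => φ x * jacDet v (Function.update (f k) i r) x) μ := fun hr =>
      hφc.integrable_mul_jacDet μ hφ.continuous v (hupd hr k)
    have hJ : ∀ {r : E → ℝ}, LipschitzWith K r →
        Integrable (fun x => r x * jacDet v (Function.update (f k) i φ) x) μ := by
      intro r hr
      obtain ⟨M, hM⟩ := hφc.isCompact.exists_bound_of_continuousOn hr.continuous.continuousOn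
      refine Integrable.mono'
        ((integrable_indicator_iff (isClosed_tsupport φ).measurableSet).2
          (integrableOn_const (C := M * B) hφc.isCompact.measure_ne_top))
        (hr.continuous.aestronglyMeasurable.mul (measurable_jacDet v _).aestronglyMeasurable)
        (Eventually.of_forall fun x => ?_)
      by_cases hx : x ∈ tsupport φ
      · rw [Set.indicator_of_mem hx, norm_mul]
        exact mul_le_mul (hM x hx) (hB _ _ fun a => norm_fderiv_le_of_lipschitz ℝ (hupd hφK k a))
          (norm_nonneg _) ((norm_nonneg _).trans (hM x hx))
      · rw [Set.indicator_of_notMem hx]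
        simp [jacDet_update_eq_zero_of_notMem_tsupport v _ i hx]
    have hparts : ∀ {r : E → ℝ}, LipschitzWith K r →
        (∫ x, φ x * jacDet v (Function.update (f k) i r) x ∂μ) +
          ∫ x, r x * jacDet v (Function.update (f k) i φ) x ∂μ = 0 := by
      intro r hr
      have h := integral_mul_jacDet_add_eq_zero μ hφ hφc hφK v (hupd hr k) i
      simp only [Function.update_idem, Function.update_self] at h
      rwa [integral_add (hI hr) (hJ hr)] at h
    simp only [sub_mul]
    rw [integral_sub (hJ hq) (hJ (hp k))]
    linarith [hparts hq, hparts (hp k)]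
  simp only [key]
  rw [← integral_zero E ℝ (μ := μ)]
  refine tendsto_integral_filter_of_dominated_convergence
    ((tsupport φ).indicator fun _ => 1 * B) (Eventually.of_forall fun k => ?_) ?_ ?_ ?_
  · exact (hq.continuous.sub (hp k).continuous).aestronglyMeasurable.mul
      (measurable_jacDet v _).aestronglyMeasurable
  · filter_upwards [Metric.tendstoUniformlyOn_iff.1 hpq 1 one_pos] with k hk
    refine Eventually.of_forall fun x => ?_
    by_cases hx : x ∈ tsupport φ
    · rw [Set.indicator_of_mem hx, norm_mul]
      exact mul_le_mul (by simpa [Real.dist_eq] using (hk x hx).le)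
        (hB _ _ fun a => norm_fderiv_le_of_lipschitz ℝ (hupd hφK k a)) (norm_nonneg _) zero_le_one
    · rw [Set.indicator_of_notMem hx]
      simp [jacDet_update_eq_zero_of_notMem_tsupport v _ i hx]
  · exact (integrable_indicator_iff (isClosed_tsupport φ).measurableSet).2
      (integrableOn_const hφc.isCompact.measure_ne_top)
  · refine Eventually.of_forall fun x => ?_
    by_cases hx : x ∈ tsupport φ
    · have h0 : Tendsto (fun k => q x - p k x) atTop (𝓝 0) := by
        simpa using tendsto_const_nhds (x := q x) |>.sub (hpq.tendsto_at hx)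
      refine h0.zero_mul_isBoundedUnder_le ⟨B, ?_⟩
      exact eventually_map.2 (Eventually.of_forall fun k =>
        hB _ _ fun a => norm_fderiv_le_of_lipschitz ℝ (hupd hφK k a))
    · simp [jacDet_update_eq_zero_of_notMem_tsupport v _ i hx]

lemma tendsto_integral_mul_jacDet {K : NNReal} {φ : E → ℝ} (hφ : ContDiff ℝ 2 φ)
    (hφc : HasCompactSupport φ) (v : ι → E) {f : ℕ → ι → E → ℝ} {g : ι → E → ℝ}
    (hf : ∀ k a, LipschitzWith K (f k a)) (hg : ∀ a, LipschitzWith K (g a))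
    (hfg : ∀ a, TendstoUniformlyOn (fun k => f k a) (g a) atTop (tsupport φ)) :
    Tendsto (fun k => ∫ x, φ x * jacDet v (f k) x ∂μ) atTop
      (𝓝 (∫ x, φ x * jacDet v g x ∂μ)) := by
  obtain ⟨L, hL⟩ := hφ.lipschitzWith_of_hasCompactSupport hφc two_ne_zero
  have hs : ∀ s : Finset ι, Tendsto (fun k => ∫ x, φ x * jacDet v (s.piecewise (f k) g) x ∂μ)
      atTop (𝓝 (∫ x, φ x * jacDet v g x ∂μ)) := by
    intro s
    induction s using Finset.induction_on with
    | empty => simp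
    | insert i s his ih =>
      have hstep := tendsto_integral_mul_jacDet_update_sub μ (K := max K L) hφ hφc
        (hL.weaken (le_max_right _ _)) v (f := fun k => s.piecewise (f k) g)
        (fun k a => by
          by_cases ha : a ∈ s
          · simpa [ha] using (hf k a).weaken (le_max_left _ _)
          · simpa [ha] using (hg a).weaken (le_max_left _ _)) i
        (fun k => (hf k i).weaken (le_max_left _ _)) ((hg i).weaken (le_max_left _ _)) (hfg i)
      have hself : ∀ k, Function.update (s.piecewise (f k) g) i (g i) = s.piecewise (f k) g := by
        intro k
        conv_rhs => rw [← Function.update_eq_self i (s.piecewise (f k) g)]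
        simp [his]
      simp only [hself] at hstep
      simpa [Finset.piecewise_insert] using hstep.add ih
  simpa using hs Finset.univ

end WeakContinuity

lemma ae_restrict_jacMinor_eq_jacDet {n : ℕ} {Ω : Set (EuclideanSpace ℝ (Fin n))}
    (hΩ : IsOpen Ω) {u w : EuclideanSpace ℝ (Fin n) → EuclideanSpace ℝ (Fin n)} {K : NNReal}
    (hw : LipschitzWith K w) (huw : Set.EqOn u w Ω) {R C : Finset (Fin n)}
    (h : C.card = R.card) :
    ∀ᵐ x ∂volume.restrict Ω, jacMinor u R C x =
      jacDet (fun b : Fin R.card =>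
          EuclideanSpace.single ((C.orderIsoOfFin h b : Fin n)) (1 : ℝ))
        (fun a y => w y (R.orderIsoOfFin rfl a : Fin n)) x := by
  filter_upwards [ae_restrict_mem hΩ.measurableSet,
    ae_restrict_of_ae (s := Ω) hw.ae_differentiableAt] with x hx hd
  have hfd : fderiv ℝ u x = fderiv ℝ w x :=
    (huw.eventuallyEq_of_mem (hΩ.mem_nhds hx)).fderiv_eq
  rw [jacMinor, dif_pos h, jacDet]
  congr 1
  ext a b
  simp only [Matrix.of_apply, hfd]
  have := ((EuclideanSpace.proj (𝕜 := ℝ) (R.orderIsoOfFin rfl a : Fin n)).hasFDerivAt.comp x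
    hd.hasFDerivAt).fderiv
  exact (congrArg (fun L => L (EuclideanSpace.single ((C.orderIsoOfFin h b : Fin n)) (1 : ℝ)))
    this).symm

lemma LipschitzWith.euclidean_apply {n : ℕ} {α : Type*} [PseudoEMetricSpace α] {K : NNReal}
    {w : α → EuclideanSpace ℝ (Fin n)} (hw : LipschitzWith K w) (i : Fin n) :
    LipschitzWith K fun y => w y i := fun x y => by
  refine le_trans ?_ (hw x y)
  rw [edist_dist, edist_dist]
  refine ENNReal.ofReal_le_ofReal ?_
  rw [dist_eq_norm, dist_eq_norm]
  exact PiLp.norm_apply_le (w x - w y) i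

/-- weak `L¹`-continuity of Jacobian minors. If `u, u₁, u₂, …`
are Lipschitz on the open set `Ω` with a uniform Lipschitz constant and
`u_k → u` uniformly on `Ω`, then for every pair of index sets `R, C` of equal
cardinality and every test function `φ ∈ C_c^∞(Ω)`,
`∫_Ω φ · det((Du_k)_{R,C}) → ∫_Ω φ · det((Du)_{R,C})`. -/
theorem jacobian_minors_weak_convergence (n : ℕ)
    (Ω : Set (EuclideanSpace ℝ (Fin n))) (hΩ : IsOpen Ω)
    (u : EuclideanSpace ℝ (Fin n) → EuclideanSpace ℝ (Fin n))
    (uk : ℕ → EuclideanSpace ℝ (Fin n) → EuclideanSpace ℝ (Fin n))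
    (K : NNReal) (hu : LipschitzOnWith K u Ω) (huk : ∀ k, LipschitzOnWith K (uk k) Ω)
    (hconv : TendstoUniformlyOn uk u atTop Ω)
    (R C : Finset (Fin n)) (hcard : R.card = C.card)
    (φ : EuclideanSpace ℝ (Fin n) → ℝ) (hφ : ContDiff ℝ (⊤ : ℕ∞) φ)
    (hφc : HasCompactSupport φ) (hφs : tsupport φ ⊆ Ω) :
    Tendsto (fun k => ∫ x in Ω, φ x * jacMinor (uk k) R C x) atTop
      (nhds (∫ x in Ω, φ x * jacMinor u R C x)) := by
  have hc : C.card = R.card := hcard.symm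
  obtain ⟨w, hw, huw⟩ := hu.extend_finite_dimension
  choose wk hwk hukwk using fun k => (huk k).extend_finite_dimension
  have hint : ∀ {z z' : EuclideanSpace ℝ (Fin n) → EuclideanSpace ℝ (Fin n)} {L : NNReal},
      LipschitzWith L z' → Set.EqOn z z' Ω → ∫ x in Ω, φ x * jacMinor z R C x =
      ∫ x, φ x * jacDet (fun b : Fin R.card =>
          EuclideanSpace.single ((C.orderIsoOfFin hc b : Fin n)) (1 : ℝ))
        (fun a y => z' y (R.orderIsoOfFin rfl a : Fin n)) x := by
    intro z z' L hz' hzz'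
    refine Eq.trans (integral_congr_ae ?_)
      (setIntegral_eq_integral_of_forall_compl_eq_zero fun x hx => by
        rw [image_eq_zero_of_notMem_tsupport fun h => hx (hφs h), zero_mul])
    filter_upwards [ae_restrict_jacMinor_eq_jacDet hΩ hz' hzz' hc] with x hx
    rw [hx]
  simp only [hint hw huw, fun k => hint (hwk k) (hukwk k)]
  refine tendsto_integral_mul_jacDet volume (contDiff_infty.1 hφ 2) hφc _
    (fun k a => (hwk k).euclidean_apply _) (fun a => hw.euclidean_apply _) fun a => ?_
  rw [Metric.tendstoUniformlyOn_iff] at hconv ⊢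
  intro ε hε
  filter_upwards [hconv ε hε] with k hk x hx
  refine lt_of_le_of_lt ?_ (hk x (hφs hx))
  rw [huw (hφs hx), hukwk k (hφs hx), dist_eq_norm, dist_eq_norm]
  exact PiLp.norm_apply_le (w x - wk k x) _
end

section
/- Let Ω ⊆ ℝⁿ be open and let u : Ω → ℝⁿ be Lipschitz. Let R, C ⊆ {1,…,n} be subsets with |R| = |C| = k ≥ 1, let i ∈ R, and for i being the r-th smallest element of R and j ∈ C the s-th smallest element of C, write ε(i,j) = (−1)^{r+s}. Then for every φ ∈ C_c^∞(Ω): ∫_Ω det((Du(x))_{R,C}) φ(x) dx = − ∫_Ω u^i(x) Σ_{j ∈ C} ∂_j φ(x) · ε(i,j) · det((Du(x))_{R∖{i}, C∖{j}}) dx, where for k = 1 the empty determinant det((Du)_{∅,∅}) is interpreted as 1. (Equivalently, the rows of the matrix of cofactors of any square submatrix of the Jacobian of a Lipschitz map are divergence-free in the sense of distributions.) -/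
open Filter Topology MeasureTheory

open scoped Convolution Pointwise

theorem ContDiff.fderiv_fderiv_apply_comm {E : Type*} [NormedAddCommGroup E] [NormedSpace ℝ E]
    {g : E → ℝ} (hg : ContDiff ℝ 2 g) (x v w : E) :
    fderiv ℝ (fun y => fderiv ℝ g y v) x w = fderiv ℝ (fun y => fderiv ℝ g y w) x v := by
  have hd : DifferentiableAt ℝ (fderiv ℝ g) x :=
    (hg.fderiv_right (m := 1) (by norm_num)).differentiable (by norm_num) x
  have hsymm := (hg.contDiffAt (x := x)).isSymmSndFDerivAt (by simp)
  have key (z : E) : fderiv ℝ (fun y => fderiv ℝ g y z) x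
      = (ContinuousLinearMap.apply ℝ ℝ z).comp (fderiv ℝ (fderiv ℝ g) x) :=
    ((ContinuousLinearMap.apply ℝ ℝ z).hasFDerivAt.comp x hd.hasFDerivAt).fderiv
  simpa [key] using hsymm.eq w v

theorem sum_sign_mul_fderiv_prod_erase_eq_zero {E ι : Type*} [NormedAddCommGroup E]
    [NormedSpace ℝ E] [Fintype ι] [DecidableEq ι] {g : ι → E → ℝ}
    (hg : ∀ a, ContDiff ℝ 2 (g a)) (e : ι → E) (i : ι) (x : E) :
    ∑ σ : Equiv.Perm ι, ((Equiv.Perm.sign σ : ℤ) : ℝ) *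
      fderiv ℝ (fun y => ∏ a ∈ Finset.univ.erase i, fderiv ℝ (g a) y (e (σ a))) x
        (e (σ i)) = 0 := by
  have hd (a : ι) (v : E) : Differentiable ℝ (fun y => fderiv ℝ (g a) y v) :=
    (((hg a).fderiv_right (m := 1) (by norm_num)).clm_apply contDiff_const).differentiable
      (by norm_num)
  have hprod (σ : Equiv.Perm ι) := (HasFDerivAt.finsetProd (u := Finset.univ.erase i)
    fun a _ => (hd a (e (σ a)) x).hasFDerivAt).fderiv
  simp only [hprod, FunLike.coe_sum, Finset.sum_apply, FunLike.coe_smul,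
    Pi.smul_apply, smul_eq_mul, Finset.mul_sum]
  rw [Finset.sum_comm]
  refine Finset.sum_eq_zero fun a ha => ?_
  have hai : a ≠ i := Finset.ne_of_mem_erase ha
  rw [← self_eq_neg]
  conv_lhs => rw [← Equiv.sum_comp (Equiv.mulRight (Equiv.swap i a))]
  rw [← Finset.sum_neg_distrib]
  refine Finset.sum_congr rfl fun σ _ => ?_
  have hp : ∏ j ∈ (Finset.univ.erase i).erase a, fderiv ℝ (g j) x (e ((σ * Equiv.swap i a) j))
      = ∏ j ∈ (Finset.univ.erase i).erase a, fderiv ℝ (g j) x (e (σ j)) := by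
    refine Finset.prod_congr rfl fun j hj => ?_
    simp only [Finset.mem_erase] at hj
    rw [Equiv.Perm.mul_apply, Equiv.swap_apply_of_ne_of_ne hj.2.1 hj.1]
  simp only [Equiv.coe_mulRight, hp]
  rw [(hg a).fderiv_fderiv_apply_comm]
  simp [Equiv.Perm.sign_swap hai.symm]

theorem LipschitzWith.norm_fderiv_apply_le {E : Type*} [NormedAddCommGroup E]
    [NormedSpace ℝ E] {f : E → ℝ} {K : NNReal}
    (hf : LipschitzWith K f) (x v : E) : ‖fderiv ℝ f x v‖ ≤ K * ‖v‖ :=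
  (fderiv ℝ f x).le_of_opNorm_le (norm_fderiv_le_of_lipschitz ℝ hf) v

theorem Matrix.norm_det_le_of_norm_le {ι : Type*} [Fintype ι] [DecidableEq ι] {A : Matrix ι ι ℝ}
    {M : ℝ} (h : ∀ a b, ‖A a b‖ ≤ M) :
    ‖A.det‖ ≤ (Fintype.card ι).factorial • M ^ Fintype.card ι :=
  Matrix.det_le (abv := AbsoluteValue.abs) h

theorem LipschitzWith.exists_norm_fderiv_apply_le {E ι κ : Type*} [NormedAddCommGroup E]
    [NormedSpace ℝ E] [Finite ι] [Finite κ] {f : ι → E → ℝ} {K : ι → NNReal}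
    (hf : ∀ a, LipschitzWith (K a) (f a)) (e : κ → E) :
    ∃ M : ℝ, (∀ a b, K a * ‖e b‖ ≤ M) ∧ ∀ x a b, ‖fderiv ℝ (f a) x (e b)‖ ≤ M := by
  obtain ⟨M, hM⟩ := Set.Finite.bddAbove (Set.finite_range fun p : ι × κ => (K p.1 : ℝ) * ‖e p.2‖)
  have hM' (a b) : K a * ‖e b‖ ≤ M := hM ⟨(a, b), rfl⟩
  exact ⟨M, hM', fun x a b => ((hf a).norm_fderiv_apply_le x (e b)).trans (hM' a b)⟩

theorem LipschitzWith.exists_lipschitzWith_mul {E : Type*} [NormedAddCommGroup E] {φ w : E → ℝ}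
    {L K : NNReal} (hφ : LipschitzWith L φ) (hφc : HasCompactSupport φ) (hw : LipschitzWith K w) :
    ∃ C, LipschitzWith C fun x => φ x * w x := by
  obtain ⟨M, hM0, hM⟩ : ∃ M, 0 ≤ M ∧ ∀ x ∈ tsupport φ, ‖w x‖ ≤ M := by
    obtain ⟨M, hM⟩ := hφc.isCompact.exists_bound_of_continuousOn hw.continuous.continuousOn
    exact ⟨|M|, abs_nonneg M, fun x hx => (hM x hx).trans (le_abs_self M)⟩
  obtain ⟨B, hB⟩ := hφc.exists_bound_of_continuous hφ.continuous
  have hB0 : 0 ≤ B := (norm_nonneg _).trans (hB 0)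
  have hM' {x : E} (hx : φ x ≠ 0) : |w x| ≤ M := hM x (subset_tsupport φ hx)
  refine ⟨(L * M + B * K).toNNReal, LipschitzWith.of_dist_le' fun x y => ?_⟩
  have h1 := hφ.dist_le_mul x y
  have h2 := hw.dist_le_mul x y
  have hd : 0 ≤ dist x y := dist_nonneg
  rw [Real.dist_eq] at h1 h2 ⊢
  have hBK : 0 ≤ B * K * dist x y := by positivity
  by_cases hx : φ x = 0
  · by_cases hy : φ y = 0
    · have hLM : 0 ≤ L * M * dist x y := by positivity
      simp only [hx, hy, zero_mul, sub_self, abs_zero]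
      nlinarith
    · calc |φ x * w x - φ y * w y| = |φ x - φ y| * |w y| := by
            rw [← abs_mul, hx, zero_mul, sub_mul, zero_mul]
        _ ≤ (L * dist x y) * M := by gcongr; exact hM' hy
        _ ≤ _ := by nlinarith
  · calc |φ x * w x - φ y * w y| = |(φ x - φ y) * w x + φ y * (w x - w y)| := by ring_nf
      _ ≤ |φ x - φ y| * |w x| + |φ y| * |w x - w y| := by
          rw [← abs_mul, ← abs_mul]; exact abs_add_le _ _
      _ ≤ (L * dist x y) * M + B * (K * dist x y) := by
          gcongr
          · exact hM' hx
          · exact hB y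
      _ = _ := by ring

section
variable {E ι : Type*} [NormedAddCommGroup E] [NormedSpace ℝ E] [FiniteDimensional ℝ E]
  [MeasurableSpace E] [BorelSpace E] (μ : Measure E) [μ.IsAddHaarMeasure]
  [Fintype ι] [DecidableEq ι]

theorem ContDiff.integral_det_fderiv_eq_zero {g : ι → E → ℝ}
    (hg : ∀ a, ContDiff ℝ 2 (g a)) (e : ι → E) (i : ι) (hc : HasCompactSupport (g i)) :
    ∫ x, Matrix.det (Matrix.of fun a b => fderiv ℝ (g a) x (e b)) ∂μ = 0 := by
  have hd (a : ι) (v : E) : ContDiff ℝ 1 (fun y => fderiv ℝ (g a) y v) :=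
    ((hg a).fderiv_right (m := 1) (by norm_num)).clm_apply contDiff_const
  set P : Equiv.Perm ι → E → ℝ := fun σ y =>
    ∏ a ∈ Finset.univ.erase i, fderiv ℝ (g a) y (e (σ a)) with hP
  have hPd (σ) : ContDiff ℝ 1 (P σ) := contDiff_prod fun a _ => hd a _
  have hPc (σ) (v : E) : Continuous fun x => fderiv ℝ (P σ) x v :=
    ((hPd σ).continuous_fderiv (by norm_num)).clm_apply continuous_const
  have hgc (v : E) : HasCompactSupport fun x => fderiv ℝ (g i) x v :=
    hc.fderiv_apply (𝕜 := ℝ) v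
  have hint₁ (σ) (v : E) : Integrable (fun x => fderiv ℝ (g i) x v * P σ x) μ :=
    ((hd i v).continuous.mul (hPd σ).continuous).integrable_of_hasCompactSupport (hgc v).mul_right
  have hint₂ (σ) (v : E) : Integrable (fun x => g i x * fderiv ℝ (P σ) x v) μ :=
    ((hg i).continuous.mul (hPc σ v)).integrable_of_hasCompactSupport hc.mul_right
  have hint₃ (σ) : Integrable (fun x => g i x * P σ x) μ :=
    ((hg i).continuous.mul (hPd σ).continuous).integrable_of_hasCompactSupport hc.mul_right
  have hint₄ (σ : Equiv.Perm ι) (v : E) : Integrable (fun x =>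
      ((Equiv.Perm.sign σ : ℤ) : ℝ) * -(g i x * fderiv ℝ (P σ) x v)) μ :=
    (hint₂ σ v).neg.const_mul _
  have hdet (x : E) : Matrix.det (Matrix.of fun a b => fderiv ℝ (g a) x (e b))
      = ∑ σ : Equiv.Perm ι, ((Equiv.Perm.sign σ : ℤ) : ℝ) *
        (fderiv ℝ (g i) x (e (σ i)) * P σ x) := by
    rw [← Matrix.det_transpose, Matrix.det_apply']
    refine Finset.sum_congr rfl fun σ _ => ?_
    simp [hP, ← Finset.mul_prod_erase Finset.univ _ (Finset.mem_univ i)]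
  simp_rw [hdet]
  rw [integral_finsetSum _ fun σ _ => (hint₁ σ _).const_mul _]
  have hparts (σ) (v : E) : ∫ x, fderiv ℝ (g i) x v * P σ x ∂μ
      = - ∫ x, g i x * fderiv ℝ (P σ) x v ∂μ := by
    rw [integral_mul_fderiv_eq_neg_fderiv_mul_of_integrable (hint₁ σ v) (hint₂ σ v) (hint₃ σ)
      (fun x _ => (hg i).differentiable (by norm_num) x)
      (fun x _ => (hPd σ).differentiable (by norm_num) x), neg_neg]
  simp_rw [integral_const_mul, hparts, ← integral_neg, ← integral_const_mul]
  rw [← integral_finsetSum _ fun σ _ => hint₄ σ _]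
  refine integral_eq_zero_of_ae (Eventually.of_forall fun x => ?_)
  have := sum_sign_mul_fderiv_prod_erase_eq_zero hg e i x
  calc (∑ σ : Equiv.Perm ι, ((Equiv.Perm.sign σ : ℤ) : ℝ) *
      -(g i x * fderiv ℝ (P σ) x (e (σ i)))) = - (g i x) *
        ∑ σ : Equiv.Perm ι, ((Equiv.Perm.sign σ : ℤ) : ℝ) *
      fderiv ℝ (P σ) x (e (σ i)) := by
        rw [Finset.mul_sum]; exact Finset.sum_congr rfl fun σ _ => by ring
    _ = 0 := by rw [this, mul_zero]

theorem LipschitzWith.fderiv_normed_convolution_apply {f : E → ℝ} {K : NNReal}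
    (hf : LipschitzWith K f) (ρ : ContDiffBump (0 : E)) (x v : E) :
    fderiv ℝ (ρ.normed μ ⋆[ContinuousLinearMap.lsmul ℝ ℝ, μ] f) x v =
      (ρ.normed μ ⋆[ContinuousLinearMap.lsmul ℝ ℝ, μ] fun y => fderiv ℝ f y v) x := by
  have hρ : Integrable (ρ.normed μ) μ := ρ.integrable_normed
  have hcont (y : E) : Continuous fun t => ρ.normed μ t • f (y - t) :=
    ρ.continuous_normed.smul (hf.continuous.comp (continuous_const.sub continuous_id))
  have hint (y : E) : Integrable (fun t => ρ.normed μ t • f (y - t)) μ :=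
    (hcont y).integrable_of_hasCompactSupport ρ.hasCompactSupport_normed.smul_right
  have hmeas : Measurable fun t => fderiv ℝ f (x - t) :=
    (measurable_fderiv ℝ f).comp (measurable_const.sub measurable_id)
  have hae : ∀ᵐ t ∂μ, DifferentiableAt ℝ f (x - t) :=
    (quasiMeasurePreserving_sub_left_of_right_invariant μ x).ae hf.ae_differentiableAt
  have hder := hasFDerivAt_integral_of_dominated_loc_of_lip (μ := μ) (x₀ := x)
    (F := fun y t => ρ.normed μ t • f (y - t))
    (F' := fun t => ρ.normed μ t • fderiv ℝ f (x - t))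
    (bound := fun t => ρ.normed μ t * K) univ_mem
    (Eventually.of_forall fun y => (hcont y).aestronglyMeasurable) (hint x)
    (ρ.continuous_normed.measurable.smul hmeas).aestronglyMeasurable
    (Eventually.of_forall fun t => by
      refine (LipschitzWith.of_dist_le_mul fun y z => ?_).lipschitzOnWith
      have hKt : 0 ≤ ρ.normed μ t * K := mul_nonneg (ρ.nonneg_normed t) K.2
      have h := hf.dist_le_mul (y - t) (z - t)
      rw [dist_sub_right] at h
      rw [dist_smul₀, Real.norm_of_nonneg (ρ.nonneg_normed t), Real.coe_nnabs, abs_of_nonneg hKt,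
        mul_assoc]
      exact mul_le_mul_of_nonneg_left h (ρ.nonneg_normed t))
    (hρ.mul_const _)
    (hae.mono fun t ht =>
      ((hasFDerivAt_comp_sub t).2 ht.hasFDerivAt).const_smul (ρ.normed μ t))
  have h2 : fderiv ℝ (ρ.normed μ ⋆[ContinuousLinearMap.lsmul ℝ ℝ, μ] f) x
      = ∫ t, ρ.normed μ t • fderiv ℝ f (x - t) ∂μ := hder.2.fderiv
  rw [h2, ContinuousLinearMap.integral_apply hder.1]
  rfl

theorem LipschitzWith.norm_fderiv_normed_convolution_apply_le {f : E → ℝ} {K : NNReal}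
    (hf : LipschitzWith K f) (ρ : ContDiffBump (0 : E)) (x v : E) :
    ‖fderiv ℝ (ρ.normed μ ⋆[ContinuousLinearMap.lsmul ℝ ℝ, μ] f) x v‖ ≤ K * ‖v‖ := by
  rw [hf.fderiv_normed_convolution_apply μ]
  refine (norm_integral_le_of_norm_le (ρ.integrable_normed.mul_const (K * ‖v‖))
    (Eventually.of_forall fun t => ?_)).trans_eq ?_
  · rw [ContinuousLinearMap.lsmul_apply, norm_smul, Real.norm_of_nonneg (ρ.nonneg_normed t)]
    exact mul_le_mul_of_nonneg_left (hf.norm_fderiv_apply_le _ _) (ρ.nonneg_normed t)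
  · rw [integral_mul_const, ρ.integral_normed, one_mul]

theorem LipschitzWith.integral_det_fderiv_eq_zero {f : ι → E → ℝ} {K : ι → NNReal}
    (hf : ∀ a, LipschitzWith (K a) (f a)) (e : ι → E) (i : ι) (hc : HasCompactSupport (f i)) :
    ∫ x, Matrix.det (Matrix.of fun a b => fderiv ℝ (f a) x (e b)) ∂μ = 0 := by
  have hpos (m : ℕ) : (0 : ℝ) < 1 / (m + 1) := Nat.one_div_pos_of_nat
  let ρ : ℕ → ContDiffBump (0 : E) := fun m =>
    ⟨1 / (m + 1) / 2, 1 / (m + 1), half_pos (hpos m), half_lt_self (hpos m)⟩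
  set g : ℕ → ι → E → ℝ := fun m a =>
    (ρ m).normed μ ⋆[ContinuousLinearMap.lsmul ℝ ℝ, μ] f a with hg
  have hgd (m : ℕ) (a : ι) : ContDiff ℝ 2 (g m a) :=
    (ρ m).hasCompactSupport_normed.contDiff_convolution_left (n := 2) _ (ρ m).contDiff_normed
      (hf a).continuous.locallyIntegrable
  set S : Set E := tsupport (f i) + Metric.closedBall 0 1
  have hS : IsCompact S := hc.isCompact.add (isCompact_closedBall 0 1)
  have hgS (m : ℕ) : Function.support (g m i) ⊆ S := by
    refine (support_convolution_subset_swap _).trans (Set.add_subset_add subset_closure ?_)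
    rw [(ρ m).support_normed_eq]
    refine Metric.ball_subset_closedBall.trans (Metric.closedBall_subset_closedBall ?_)
    exact (div_le_one (by positivity)).2 (by simp)
  have hgc (m : ℕ) : HasCompactSupport (g m i) :=
    HasCompactSupport.of_support_subset_isCompact hS (hgS m)
  have hgS' (m : ℕ) (x : E) (hx : x ∉ S) : fderiv ℝ (g m i) x = 0 := by
    by_contra h
    exact hx (closure_minimal (hgS m) hS.isClosed (support_fderiv_subset ℝ h))
  obtain ⟨M, hM, -⟩ := LipschitzWith.exists_norm_fderiv_apply_le hf e
  have hlim : ∀ᵐ x ∂μ, ∀ a b, Tendsto (fun m => fderiv ℝ (g m a) x (e b)) atTop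
      (𝓝 (fderiv ℝ (f a) x (e b))) := by
    refine ae_all_iff.2 fun a => ae_all_iff.2 fun b => ?_
    have hloc : LocallyIntegrable (fun y => fderiv ℝ (f a) y (e b)) μ := by
      refine (locallyIntegrable_const (μ := μ) ((K a : ℝ) * ‖e b‖)).mono
        (measurable_fderiv_apply_const ℝ (f a) (e b)).aestronglyMeasurable
        (Eventually.of_forall fun x => ?_)
      exact ((hf a).norm_fderiv_apply_le x (e b)).trans (le_abs_self _)
    filter_upwards [ContDiffBump.ae_convolution_tendsto_right_of_locallyIntegrable (φ := ρ)
      (K := 2) tendsto_one_div_add_atTop_nhds_zero_nat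
      (Eventually.of_forall fun m => by simp only [ρ]; linarith) hloc] with x hx
    simpa only [hg, (hf a).fderiv_normed_convolution_apply μ] using hx
  have hT : Tendsto (fun m => ∫ x, Matrix.det (Matrix.of fun a b => fderiv ℝ (g m a) x (e b)) ∂μ)
      atTop (𝓝 (∫ x, Matrix.det (Matrix.of fun a b => fderiv ℝ (f a) x (e b)) ∂μ)) := by
    refine tendsto_integral_of_dominated_convergence
      (S.indicator fun _ => (Fintype.card ι).factorial • M ^ Fintype.card ι) (fun m => ?_) ?_
      (fun m => Eventually.of_forall fun x => ?_) ?_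
    · refine (Continuous.matrix_det (continuous_pi fun a =>
        continuous_pi fun b => ?_)).aestronglyMeasurable
      exact ((hgd m a).continuous_fderiv (by norm_num)).clm_apply continuous_const
    · exact (integrable_indicator_iff hS.isClosed.measurableSet).2
        (integrableOn_const hS.measure_lt_top.ne)
    · by_cases hx : x ∈ S
      · rw [Set.indicator_of_mem hx]
        exact Matrix.norm_det_le_of_norm_le fun a b =>
          ((hf a).norm_fderiv_normed_convolution_apply_le μ (ρ m) x (e b)).trans (hM a b)
      · rw [Set.indicator_of_notMem hx, Matrix.det_eq_zero_of_row_eq_zero i, norm_zero]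
        intro b
        simp [hgS' m x hx]
    · filter_upwards [hlim] with x hx
      exact ((continuous_id.matrix_det).tendsto _).comp
        (tendsto_pi_nhds.2 fun a => tendsto_pi_nhds.2 fun b => hx a b)
  refine tendsto_nhds_unique hT ?_
  simp_rw [fun m => ContDiff.integral_det_fderiv_eq_zero μ (hgd m) e i (hgc m)]
  exact tendsto_const_nhds

theorem LipschitzWith.integral_mul_det_fderiv_eq_neg {m : ℕ} {f : Fin (m + 1) → E → ℝ}
    {K : Fin (m + 1) → NNReal} (hf : ∀ a, LipschitzWith (K a) (f a)) (e : Fin (m + 1) → E)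
    (i : Fin (m + 1)) {φ : E → ℝ} (hφ : ContDiff ℝ 1 φ) (hφc : HasCompactSupport φ) :
    ∫ x, Matrix.det (Matrix.of fun a b => fderiv ℝ (f a) x (e b)) * φ x ∂μ =
      - ∫ x, f i x * ∑ s, fderiv ℝ φ x (e s) * (-1) ^ (i + s : ℕ) *
        Matrix.det (Matrix.of fun a b =>
          fderiv ℝ (f (i.succAbove a)) x (e (s.succAbove b))) ∂μ := by
  obtain ⟨L, hL⟩ := hφ.lipschitzWith_of_hasCompactSupport hφc (by norm_num)
  obtain ⟨C, hC⟩ := hL.exists_lipschitzWith_mul hφc (hf i)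
  have hF (a) : LipschitzWith (Function.update K i C a)
      (Function.update f i (fun x => φ x * f i x) a) := by
    rcases eq_or_ne a i with rfl | ha
    · simpa using hC
    · simpa [ha] using hf a
  have key := LipschitzWith.integral_det_fderiv_eq_zero μ hF e i
    (by rw [Function.update_self]; exact hφc.mul_right)
  obtain ⟨M, -, hM⟩ := LipschitzWith.exists_norm_fderiv_apply_le hf e
  have hmeas {κ : Type} [Fintype κ] [DecidableEq κ] (r c : κ → Fin (m + 1)) :
      Measurable fun x => Matrix.det (Matrix.of fun a b => fderiv ℝ (f (r a)) x (e (c b))) := by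
    simp_rw [Matrix.det_apply']
    exact Finset.measurable_fun_sum _ fun σ _ => (Finset.measurable_fun_prod _ fun b _ =>
      measurable_fderiv_apply_const ℝ (f (r (σ b))) (e (c b))).const_mul _
  have hint₁ : Integrable (fun x =>
      Matrix.det (Matrix.of fun a b => fderiv ℝ (f a) x (e b)) * φ x) μ :=
    (hφ.continuous.integrable_of_hasCompactSupport hφc).bdd_mul
      (hmeas id id).aestronglyMeasurable
      (Eventually.of_forall fun x => Matrix.norm_det_le_of_norm_le fun a b => hM x a b)
  have hint₂ : Integrable (fun x => f i x * ∑ s, fderiv ℝ φ x (e s) * (-1) ^ (i + s : ℕ) *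
        Matrix.det (Matrix.of fun a b =>
          fderiv ℝ (f (i.succAbove a)) x (e (s.succAbove b)))) μ := by
    simp_rw [Finset.mul_sum, ← mul_assoc]
    refine integrable_finsetSum _ fun s _ => Integrable.mul_bdd ?_
      (hmeas i.succAbove s.succAbove).aestronglyMeasurable
      (Eventually.of_forall fun x => Matrix.norm_det_le_of_norm_le fun a b => hM x _ _)
    refine (((hf i).continuous.mul ((hφ.continuous_fderiv (by norm_num)).clm_apply
      continuous_const)).integrable_of_hasCompactSupport ?_).mul_const _
    exact (hφc.fderiv_apply (𝕜 := ℝ) (e s)).mul_left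
  rw [eq_neg_iff_add_eq_zero, ← integral_add hint₁ hint₂, ← key]
  refine integral_congr_ae ?_
  filter_upwards [(hf i).ae_differentiableAt (μ := μ)] with x hx
  set D : Matrix (Fin (m + 1)) (Fin (m + 1)) ℝ := Matrix.of fun a b => fderiv ℝ (f a) x (e b)
  have hrow : (Matrix.of fun a b =>
      fderiv ℝ (Function.update f i (fun x => φ x * f i x) a) x (e b))
      = D.updateRow i (φ x • D i + f i x • fun b => fderiv ℝ φ x (e b)) := by
    ext a b
    rcases eq_or_ne a i with rfl | ha
    · have hp := fderiv_fun_mul (hφ.differentiable (by norm_num) x) hx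
      simp [D, hp]
    · simp [D, ha]
  rw [hrow, Matrix.det_updateRow_add, Matrix.det_updateRow_smul, Matrix.det_updateRow_smul,
    Matrix.updateRow_eq_self, mul_comm,
    Matrix.det_succ_row (D.updateRow i fun b => fderiv ℝ φ x (e b)) i]
  congr 2
  refine Finset.sum_congr rfl fun s _ => ?_
  rw [Matrix.submatrix_updateRow_succAbove, Matrix.updateRow_self, mul_comm (_ ^ _)]
  rfl
end

theorem jacMinor_eq_det {n m : ℕ} (u : EuclideanSpace ℝ (Fin n) → EuclideanSpace ℝ (Fin n))
    {R C : Finset (Fin n)} (hR : R.card = m) (hC : C.card = m) {r c : Fin m → Fin n}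
    (hr : StrictMono r) (hrR : ∀ a, r a ∈ R) (hc : StrictMono c) (hcC : ∀ a, c a ∈ C)
    (x : EuclideanSpace ℝ (Fin n)) :
    jacMinor u R C x =
      Matrix.det (Matrix.of fun a b => fderiv ℝ u x (EuclideanSpace.single (c b) 1) (r a)) := by
  subst hR
  obtain rfl := R.orderEmbOfFin_unique rfl hrR hr
  obtain rfl := C.orderEmbOfFin_unique hC hcC hc
  simp [jacMinor, hC]

/-- the rows of cofactors of Jacobian submatrices of a Lipschitz
map are divergence free (in the distributional sense): for `R, C ⊆ {1,…,n}` of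
cardinality `k ≥ 1`, `i ∈ R` the `r`-th smallest element of `R` and, for
`j ∈ C` the `s`-th smallest element of `C`, with `ε(i,j) = (-1)^(r+s)`,
`∫ det((Du)_{R,C}) φ = -∫ uⁱ Σ_{j ∈ C} ∂_j φ · ε(i,j) · det((Du)_{R∖{i},C∖{j}})`
for every `φ ∈ C_c^∞(Ω)`. -/
theorem cofactor_rows_divergence_free (n : ℕ)
    (Ω : Set (EuclideanSpace ℝ (Fin n))) (hΩ : IsOpen Ω)
    (u : EuclideanSpace ℝ (Fin n) → EuclideanSpace ℝ (Fin n))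
    (K : NNReal) (hu : LipschitzOnWith K u Ω)
    (k : ℕ) (hk : 1 ≤ k) (R C : Finset (Fin n)) (hR : R.card = k) (hC : C.card = k)
    (i : Fin n) (hi : i ∈ R)
    (φ : EuclideanSpace ℝ (Fin n) → ℝ) (hφ : ContDiff ℝ (⊤ : ℕ∞) φ)
    (hφc : HasCompactSupport φ) (hφs : tsupport φ ⊆ Ω) :
    ∫ x in Ω, jacMinor u R C x * φ x =
      - ∫ x in Ω, u x i * ∑ j ∈ C.attach,
          fderiv ℝ φ x (EuclideanSpace.single (j : Fin n) 1) *
          (-1 : ℝ) ^ ((((R.orderIsoOfFin hR).symm ⟨i, hi⟩ : Fin k) : ℕ) +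
            (((C.orderIsoOfFin hC).symm j : Fin k) : ℕ)) *
          jacMinor u (R.erase i) (C.erase (j : Fin n)) x := by
  obtain ⟨m, rfl⟩ : ∃ m, k = m + 1 := ⟨k - 1, by omega⟩
  obtain ⟨w, hw, huw⟩ := hu.extend_finite_dimension
  set r : Fin (m + 1) → Fin n := ⇑(R.orderEmbOfFin hR) with hr
  set c : Fin (m + 1) → Fin n := ⇑(C.orderEmbOfFin hC) with hc
  have hrm : StrictMono r := (R.orderEmbOfFin hR).strictMono
  have hcm : StrictMono c := (C.orderEmbOfFin hC).strictMono
  have hrR (a) : r a ∈ R := R.orderEmbOfFin_mem hR a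
  have hcC (a) : c a ∈ C := C.orderEmbOfFin_mem hC a
  obtain ⟨i', rfl⟩ : ∃ i', r i' = i := by
    have : i ∈ Set.range r := by rw [hr, Finset.range_orderEmbOfFin]; exact hi
    exact this
  have hi' : (R.orderIsoOfFin hR).symm ⟨r i', hi⟩ = i' := by
    rw [OrderIso.symm_apply_eq]; rfl
  have hf (a) : LipschitzWith _ (fun x => w x (r a)) :=
    (EuclideanSpace.proj (𝕜 := ℝ) (r a)).lipschitz.comp hw
  have main := LipschitzWith.integral_mul_det_fderiv_eq_neg volume hf
    (fun b => EuclideanSpace.single (c b) 1) i' (hφ.of_le (by exact_mod_cast le_top)) hφc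
  have hfd : ∀ᵐ x, x ∈ Ω → ∀ a v, fderiv ℝ (fun y => w y (r a)) x v = fderiv ℝ u x v (r a) := by
    filter_upwards [hw.ae_differentiableAt] with x hx hxΩ a v
    rw [(huw.eventuallyEq_of_mem (hΩ.mem_nhds hxΩ)).fderiv_eq]
    have := (EuclideanSpace.proj (𝕜 := ℝ) (r a)).hasFDerivAt.comp x hx.hasFDerivAt
    exact DFunLike.congr_fun this.fderiv v
  have hφ0 (x) (hx : x ∉ Ω) : φ x = 0 := image_eq_zero_of_notMem_tsupport fun h => hx (hφs h)
  have hφ0' (x) (hx : x ∉ Ω) : fderiv ℝ φ x = 0 := by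
    by_contra h
    exact hx (hφs (support_fderiv_subset ℝ h))
  rw [← setIntegral_eq_integral_of_forall_compl_eq_zero (s := Ω) (μ := volume)
      fun x hx => by rw [hφ0 x hx, mul_zero],
    ← setIntegral_eq_integral_of_forall_compl_eq_zero (s := Ω) (μ := volume)
      fun x hx => by simp [hφ0' x hx]] at main
  convert main using 1
  · refine setIntegral_congr_ae hΩ.measurableSet ?_
    filter_upwards [hfd] with x hx hxΩ
    rw [jacMinor_eq_det u hR hC hrm hrR hcm hcC]
    simp_rw [hx hxΩ]
  · congr 1
    refine setIntegral_congr_ae hΩ.measurableSet ?_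
    filter_upwards [hfd] with x hx hxΩ
    rw [huw hxΩ, ← Finset.univ_eq_attach, ← (C.orderIsoOfFin hC).toEquiv.sum_comp]
    congr 1
    refine Finset.sum_congr rfl fun s _ => ?_
    have hs : ((C.orderIsoOfFin hC s : C) : Fin n) = c s := rfl
    simp only [hx hxΩ, hi', RelIso.coe_fn_toEquiv, OrderIso.symm_apply_apply, hs]
    rw [jacMinor_eq_det u (m := m) (by simp [Finset.card_erase_of_mem (hrR i'), hR])
      (by simp [Finset.card_erase_of_mem (hcC s), hC])
      (hrm.comp (Fin.strictMono_succAbove i'))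
      (fun a => Finset.mem_erase.2 ⟨hrm.injective.ne (Fin.succAbove_ne i' a), hrR _⟩)
      (hcm.comp (Fin.strictMono_succAbove s))
      (fun a => Finset.mem_erase.2 ⟨hcm.injective.ne (Fin.succAbove_ne s a), hcC _⟩)]
    rfl
end

section
/- Let c ≥ 0 and let w, w₁, w₂, … ∈ W(ℝⁿ,c) be Lipschitz functions on ℝⁿ such that w_k → w uniformly on ℝⁿ, and let s > c. Fix z ∈ ℝⁿ, and for each k let x_k be the unique point with z − s x_k ∈ ∂w_k(x_k), and let x be the unique point with z − s x ∈ ∂w(x). Then x_k → x (and hence z − s x_k → z − s x) as k → ∞. -/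
open Filter Topology RealInnerProductSpace

/-- A subgradient of a semi-convex function supports it globally from below, up to a quadratic. -/
theorem SubGrad.add_inner_sub_le_of_semiconvex {n : ℕ} {c : ℝ} (hc : 0 ≤ c)
    {w : EuclideanSpace ℝ (Fin n) → ℝ}
    (hw : ConvexOn ℝ Set.univ fun x => w x + c / 2 * ‖x‖ ^ 2)
    {x p : EuclideanSpace ℝ (Fin n)} (hp : p ∈ SubGrad Set.univ w x)
    (y : EuclideanSpace ℝ (Fin n)) :
    w x + ⟪p, y - x⟫ - c / 2 * ‖y - x‖ ^ 2 ≤ w y := by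
  rcases eq_or_ne y x with rfl | hyx
  · simp
  obtain ⟨d, rfl⟩ : ∃ d, y = x + d := ⟨y - x, by abel⟩
  have hd : d ≠ 0 := by simpa using hyx
  have hdn : 0 < ‖d‖ := norm_pos_iff.mpr hd
  rw [add_sub_cancel_left]
  refine le_of_forall_pos_le_add fun δ hδ => ?_
  have hε : 0 < δ / ‖d‖ := div_pos hδ hdn
  have htend : Tendsto (fun t : ℝ => x + t • d) (𝓝[>] 0)
      (nhdsWithin x (Set.univ \ {x})) := by
    refine tendsto_nhdsWithin_iff.mpr ⟨?_, ?_⟩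
    · have hcont : Continuous fun t : ℝ => x + t • d := by fun_prop
      simpa using (hcont.tendsto 0).mono_left nhdsWithin_le_nhds
    · filter_upwards [self_mem_nhdsWithin] with t ht
      simp [hd, ne_of_gt (Set.mem_Ioi.mp ht)]
  obtain ⟨t, hq, ht0, ht1⟩ := ((htend.eventually (hp _ hε)).and
    (Ioo_mem_nhdsGT (zero_lt_one' ℝ))).exists
  have hquot : -(t * δ) ≤ w (x + t • d) - w x - t * ⟪p, d⟫ := by
    rw [add_sub_cancel_left, norm_smul, Real.norm_of_nonneg ht0.le, inner_smul_right,
      le_div_iff₀ (by positivity)] at hq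
    calc -(t * δ) = -(δ / ‖d‖) * (t * ‖d‖) := by field_simp
      _ ≤ _ := hq
  have hconvex := hw.2 (Set.mem_univ x) (Set.mem_univ (x + d)) (sub_nonneg.mpr ht1.le) ht0.le
    (sub_add_cancel 1 t)
  have hcomb : (1 - t) • x + t • (x + d) = x + t • d := by module
  simp only [hcomb, smul_eq_mul] at hconvex
  rw [norm_add_sq_real x (t • d), norm_add_sq_real x d, norm_smul,
    Real.norm_of_nonneg ht0.le, inner_smul_right] at hconvex
  have hsq : 0 ≤ c / 2 * t ^ 2 * ‖d‖ ^ 2 := by positivity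
  refine le_of_mul_le_mul_left ?_ ht0
  linarith

/-- continuity of resolvents under uniform convergence. Let
`w_k, w ∈ W(ℝⁿ, c)` be Lipschitz with `w_k → w` uniformly on `ℝⁿ`, and let
`s > c`. Fix `z`, and let `x_k` (resp. `x`) be the unique point with
`z - s x_k ∈ ∂w_k(x_k)` (resp. `z - s x ∈ ∂w(x)`). Then `x_k → x`. -/
theorem resolvent_continuous_under_uniform_convergence (n : ℕ) (c : ℝ) (hc : 0 ≤ c)
    (w : EuclideanSpace ℝ (Fin n) → ℝ) (wk : ℕ → EuclideanSpace ℝ (Fin n) → ℝ)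
    (hw : ConvexOn ℝ Set.univ fun x => w x + c / 2 * ‖x‖ ^ 2)
    (hwk : ∀ k, ConvexOn ℝ Set.univ fun x => wk k x + c / 2 * ‖x‖ ^ 2)
    (hwLip : ∃ K : NNReal, LipschitzWith K w)
    (hwkLip : ∀ k, ∃ K : NNReal, LipschitzWith K (wk k))
    (hconv : TendstoUniformly wk w atTop)
    (s : ℝ) (hs : c < s) (z : EuclideanSpace ℝ (Fin n))
    (xk : ℕ → EuclideanSpace ℝ (Fin n)) (x : EuclideanSpace ℝ (Fin n))
    (hxk : ∀ k, z - s • xk k ∈ SubGrad Set.univ (wk k) (xk k))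
    (hx : z - s • x ∈ SubGrad Set.univ w x) :
    Tendsto xk atTop (nhds x) := by
  rw [Metric.tendsto_nhds]
  intro ε hε
  have hsc : 0 < s - c := sub_pos.mpr hs
  have hη : 0 < (s - c) * ε ^ 2 / 2 := by positivity
  filter_upwards [Metric.tendstoUniformly_iff.mp hconv _ hη] with k hk
  have hlower := SubGrad.add_inner_sub_le_of_semiconvex hc hw hx (xk k)
  have hlower_k := SubGrad.add_inner_sub_le_of_semiconvex hc (hwk k) (hxk k) x
  have hinner : ⟪z - s • x, xk k - x⟫ + ⟪z - s • xk k, x - xk k⟫ = s * ‖xk k - x‖ ^ 2 := by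
    rw [← neg_sub (xk k) x, inner_neg_right, ← sub_eq_add_neg, ← inner_sub_left,
      show z - s • x - (z - s • xk k) = s • (xk k - x) by module, real_inner_smul_left,
      real_inner_self_eq_norm_sq]
  rw [norm_sub_rev x (xk k)] at hlower_k
  have hclose := abs_lt.mp (hk x)
  have hclose_k := abs_lt.mp (hk (xk k))
  rw [dist_eq_norm]
  refine lt_of_pow_lt_pow_left₀ 2 hε.le (lt_of_mul_lt_mul_left ?_ hsc.le)
  linarith
end

section
/- Let w : ℝⁿ → ℝ be a convex function. Then the set of points that belong to the subgradient of w at two distinct points, namely {y ∈ ℝⁿ : there exist x₁ ≠ x₂ in ℝⁿ with y ∈ ∂w(x₁) ∩ ∂w(x₂)}, has n-dimensional Lebesgue measure zero. -/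
open MeasureTheory RealInnerProductSpace

section

variable {E : Type*} [NormedAddCommGroup E] [InnerProductSpace ℝ E]

/-- The Legendre transform of `w` restricted to the closed ball of radius `R`. -/
noncomputable def ballConjugate (w : E → ℝ) (R : ℝ) (y : E) : ℝ :=
  ⨆ x : Metric.closedBall (0 : E) R, (⟪y, (x : E)⟫ - w x)

lemma bddAbove_range_inner_sub [FiniteDimensional ℝ E] {w : E → ℝ} (hw : Continuous w)
    (R : ℝ) (y : E) :
    BddAbove (Set.range fun x : Metric.closedBall (0 : E) R ↦ ⟪y, (x : E)⟫ - w x) := by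
  have : ProperSpace E := FiniteDimensional.proper ℝ E
  have : CompactSpace (Metric.closedBall (0 : E) R) :=
    isCompact_iff_compactSpace.1 (isCompact_closedBall 0 R)
  exact (isCompact_range (by fun_prop)).bddAbove

lemma inner_sub_le_ballConjugate [FiniteDimensional ℝ E] {w : E → ℝ} (hw : Continuous w)
    {R : ℝ} {x : E} (hx : ‖x‖ ≤ R) (y : E) : ⟪y, x⟫ - w x ≤ ballConjugate w R y :=
  le_ciSup (bddAbove_range_inner_sub hw R y) ⟨x, by simpa using hx⟩

lemma lipschitzWith_ballConjugate [FiniteDimensional ℝ E] {w : E → ℝ} (hw : Continuous w)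
    (R : NNReal) : LipschitzWith R (ballConjugate w R) := by
  refine LipschitzWith.of_le_add_mul R fun y y' ↦ ?_
  have : Nonempty (Metric.closedBall (0 : E) R) := ⟨⟨0, by simp⟩⟩
  refine ciSup_le fun ⟨x, hx⟩ ↦ ?_
  have hxR : ‖x‖ ≤ R := by simpa using hx
  have h₁ := inner_sub_le_ballConjugate hw hxR y'
  have h₂ : ⟪y - y', x⟫ ≤ R * dist y y' := by
    rw [dist_eq_norm, mul_comm]
    exact (real_inner_le_norm _ _).trans (by gcongr)
  rw [inner_sub_left] at h₂
  dsimp only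
  linarith

/-- If `y` is a subgradient of `w` at `x`, then `x` is the gradient of the conjugate at `y`. -/
lemma fderiv_ballConjugate_eq [FiniteDimensional ℝ E] {w : E → ℝ} (hw : Continuous w)
    {R : ℝ} {x y : E} (hx : ‖x‖ ≤ R) (hy : ∀ z, w x + ⟪y, z - x⟫ ≤ w z)
    (hd : DifferentiableAt ℝ (ballConjugate w R) y) :
    fderiv ℝ (ballConjugate w R) y = innerSL ℝ x := by
  have : Nonempty (Metric.closedBall (0 : E) R) := ⟨⟨x, by simpa using hx⟩⟩
  have hle : ballConjugate w R y ≤ ⟪y, x⟫ - w x := by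
    refine ciSup_le fun z ↦ ?_
    have := hy z
    rw [inner_sub_right] at this
    linarith
  have hmin : IsLocalMin (fun y' ↦ ballConjugate w R y' - innerSL ℝ x y') y := by
    refine Filter.Eventually.of_forall fun y' ↦ ?_
    have := inner_sub_le_ballConjugate hw hx y'
    simp only [innerSL_apply_apply, real_inner_comm _ x]
    linarith
  exact sub_eq_zero.1 (hmin.hasFDerivAt_eq_zero
    (hd.hasFDerivAt.sub (innerSL ℝ x).hasFDerivAt))

end

/-- for a convex function `w : ℝⁿ → ℝ`, the set of points `y`
belonging to the subgradient of `w` at two distinct points (where the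
subgradient of `w` at `x` is `{p : ∀ z, w z ≥ w x + ⟪p, z - x⟫}`) has
`n`-dimensional Lebesgue measure zero. -/
theorem measure_zero_of_common_subgradients (n : ℕ)
    (w : EuclideanSpace ℝ (Fin n) → ℝ) (hw : ConvexOn ℝ Set.univ w) :
    volume {y : EuclideanSpace ℝ (Fin n) |
      ∃ x₁ x₂ : EuclideanSpace ℝ (Fin n), x₁ ≠ x₂ ∧
        (∀ z, w x₁ + ⟪y, z - x₁⟫ ≤ w z) ∧ (∀ z, w x₂ + ⟪y, z - x₂⟫ ≤ w z)} = 0 := by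
  have hwc : Continuous w := hw.locallyLipschitz.continuous
  have hae : ∀ᵐ y, ∀ k : ℕ, DifferentiableAt ℝ (ballConjugate w (k : NNReal)) y :=
    ae_all_iff.2 fun k ↦ (lipschitzWith_ballConjugate hwc k).ae_differentiableAt
  refine measure_mono_null ?_ hae
  rintro y ⟨x₁, x₂, hne, h₁, h₂⟩ hy
  obtain ⟨k, hk⟩ := exists_nat_ge (max ‖x₁‖ ‖x₂‖)
  have e₁ := fderiv_ballConjugate_eq hwc (by simpa using (le_max_left _ _).trans hk) h₁ (hy k)
  have e₂ := fderiv_ballConjugate_eq hwc (by simpa using (le_max_right _ _).trans hk) h₂ (hy k)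
  exact hne ((innerSL_inj (𝕜 := ℝ)).1 (e₁.symm.trans e₂))
end
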